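/- arXiv:2605.09991 — 3 statements merged into one kernel-verified Lean document; each statement's English description precedes it below -/
import Mathlib

section
/- Let R ∈ {Frobenius norm ‖·‖_F, operator norm ‖·‖_op}. Then for every A ∈ O_R(λ) there exists a continuous path γ : [0,1] → O_R(λ) with γ(0) = A and γ(1) ∈ O_R^{nm}(λ), the set of non-mergeable solutions. -/
open scoped BigOperators

noncomputable def relu (x : ℝ) : ℝ := max x 0

/-- Output of a two-layer ReLU network: `(XW)₊ α`. -/
noncomputable def nnOut {N D M : Type*} [Fintype N] [Fintype D] [Fintype M]
    (X : Matrix N D ℝ) (W : Matrix D M ℝ) (a : M → ℝ) : N → ℝ :=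
  ((X * W).map relu).mulVec a

/-- Entrywise max norm of a matrix. -/
noncomputable def maxNorm {D M : Type*} [Fintype D] [Fintype M] (W : Matrix D M ℝ) : ℝ :=
  ⨆ i, ⨆ j, |W i j|

/-- Frobenius norm of a matrix. -/
noncomputable def frobNorm {D M : Type*} [Fintype D] [Fintype M] (W : Matrix D M ℝ) : ℝ :=
  Real.sqrt (∑ i, ∑ j, (W i j) ^ 2)

/-- Euclidean (ℓ2) norm of a vector. -/
noncomputable def l2norm {M : Type*} [Fintype M] (v : M → ℝ) : ℝ :=
  Real.sqrt (∑ i, (v i) ^ 2)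

/-- ℓ∞ norm of a vector. -/
noncomputable def linfNorm {M : Type*} [Fintype M] (v : M → ℝ) : ℝ :=
  ⨆ i, |v i|

/-- Operator norm (largest singular value) of a matrix, as the supremum of
`‖W v‖₂` over the Euclidean unit ball. -/
noncomputable def opNorm {D M : Type*} [Fintype D] [Fintype M] (W : Matrix D M ℝ) : ℝ :=
  ⨆ v : {v : M → ℝ // l2norm v ≤ 1}, l2norm (W.mulVec v.1)

/-- The `i`-th column of a matrix. -/
def mcol {D M R : Type*} (W : Matrix D M R) (i : M) : D → R := fun r => W r i

/-- Regularized solution set `O_R(λ)`. -/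
def solSet {N D M : Type*} [Fintype N] [Fintype D] [Fintype M]
    (X : Matrix N D ℝ) (y : N → ℝ)
    (R : Matrix D M ℝ → ℝ) (Rv : (M → ℝ) → ℝ) (lam : ℝ) :
    Set (Matrix D M ℝ × (M → ℝ)) :=
  {p | nnOut X p.1 p.2 = y ∧ R p.1 ≤ 1 / lam ∧ Rv p.2 ≤ 1 / lam}

/-- Hyperplane arrangement pattern `1(Xh ≥ 0)` of a vector `h`. -/
noncomputable def pattern {N D : Type*} [Fintype N] [Fintype D]
    (X : Matrix N D ℝ) (h : D → ℝ) : N → Bool :=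
  fun i => decide (0 ≤ X.mulVec h i)

/-- A pair `(W, α)` has inactive neurons removed: `αᵢ • Wᵢ = 0` implies `Wᵢ = 0` and `αᵢ = 0`. -/
def removedInactive {D M : Type*} (p : Matrix D M ℝ × (M → ℝ)) : Prop :=
  ∀ i, p.2 i • mcol p.1 i = 0 → mcol p.1 i = 0 ∧ p.2 i = 0

/-- The non-mergeable solution set `O_R^{nm}(λ)`. -/
def nonMergeable {n d m : ℕ} (X : Matrix (Fin n) (Fin d) ℝ) (y : Fin n → ℝ)
    (R : Matrix (Fin d) (Fin m) ℝ → ℝ) (Rv : (Fin m → ℝ) → ℝ) (lam : ℝ) :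
    Set (Matrix (Fin d) (Fin m) ℝ × (Fin m → ℝ)) :=
  {p ∈ solSet X y R Rv lam | removedInactive p ∧
    ∀ i j : Fin m, i ≠ j → p.2 i • mcol p.1 i ≠ 0 → p.2 j • mcol p.1 j ≠ 0 →
      pattern X (mcol p.1 i) ≠ pattern X (mcol p.1 j) ∨ ¬((0 ≤ p.2 i) ↔ (0 ≤ p.2 j))}

def Contr {M : Type*} [Fintype M] (C : Matrix M M ℝ) : Prop :=
  ∀ v : M → ℝ, ∑ k, (C.mulVec v k) ^ 2 ≤ ∑ k, v k ^ 2

lemma frob_mul_le {D M : Type*} [Fintype D] [Fintype M] (W : Matrix D M ℝ) (C : Matrix M M ℝ)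
    (h : Contr C.transpose) : frobNorm (W * C) ≤ frobNorm W := by
  unfold frobNorm
  apply Real.sqrt_le_sqrt
  apply Finset.sum_le_sum
  intro r _
  have h1 : ∀ k, (W * C) r k = C.transpose.mulVec (W r) k := by
    intro k
    simp [Matrix.mul_apply, Matrix.mulVec, dotProduct, mul_comm]
  simp only [h1]
  exact h (W r)

lemma opNorm_bdd {D M : Type*} [Fintype D] [Fintype M] (W : Matrix D M ℝ) :
    BddAbove (Set.range fun v : {v : M → ℝ // l2norm v ≤ 1} => l2norm (W.mulVec v.1)) := by
  refine ⟨Real.sqrt (∑ r, ∑ k, W r k ^ 2), ?_⟩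
  rintro _ ⟨⟨v, hv⟩, rfl⟩
  apply Real.sqrt_le_sqrt
  apply Finset.sum_le_sum
  intro r _
  have hv' : ∑ k, v k ^ 2 ≤ 1 := by
    unfold l2norm at hv
    rwa [Real.sqrt_le_one] at hv
  have := Finset.sum_mul_sq_le_sq_mul_sq Finset.univ (W r) v
  have h0 : 0 ≤ ∑ k, W r k ^ 2 := by positivity
  simp only [Matrix.mulVec, dotProduct]
  nlinarith

lemma op_mul_le {D M : Type*} [Fintype D] [Fintype M] (W : Matrix D M ℝ) (C : Matrix M M ℝ)
    (h : Contr C) : opNorm (W * C) ≤ opNorm W := by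
  unfold opNorm
  have : Nonempty {v : M → ℝ // l2norm v ≤ 1} := ⟨⟨0, by simp [l2norm]⟩⟩
  apply ciSup_le
  rintro ⟨v, hv⟩
  have hc : l2norm (C.mulVec v) ≤ 1 := (Real.sqrt_le_sqrt (h v)).trans hv
  have := le_ciSup (opNorm_bdd W) ⟨C.mulVec v, hc⟩
  simpa [Matrix.mulVec_mulVec] using this

def mixC {M : Type*} [DecidableEq M] (S : Finset M) (s : ℝ) (p q : M → ℝ) :
    Matrix M M ℝ :=
  fun l k => (if l = k then (if l ∈ S then s else 1) else 0) + (1 - s) * (p l * q k)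

lemma mixC_transpose {M : Type*} [DecidableEq M] (S : Finset M) (s : ℝ) (p q : M → ℝ) :
    (mixC S s p q).transpose = mixC S s q p := by
  ext l k
  simp only [mixC, Matrix.transpose_apply]
  by_cases h : l = k
  · subst h; rw [mul_comm (p l)]
  · rw [if_neg h, if_neg (Ne.symm h), mul_comm (p k)]

lemma mixC_mulVec {M : Type*} [Fintype M] [DecidableEq M] (S : Finset M) (s : ℝ) (p q v : M → ℝ)
    (l : M) : (mixC S s p q).mulVec v l =
      (if l ∈ S then s else 1) * v l + (1 - s) * (p l * ∑ k, q k * v k) := by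
  simp only [mixC, Matrix.mulVec, dotProduct, add_mul, Finset.sum_add_distrib, ite_mul, zero_mul,
    Finset.sum_ite_eq, Finset.mem_univ, if_true, Finset.mul_sum]
  congr 1
  apply Finset.sum_congr rfl
  intros; ring

lemma mixC_contr {M : Type*} [Fintype M] [DecidableEq M] (S : Finset M) (s : ℝ) (p q : M → ℝ)
    (hs0 : 0 ≤ s) (hs1 : s ≤ 1) (hp : ∀ k, k ∉ S → p k = 0) (hq : ∀ k, k ∉ S → q k = 0)
    (hp1 : ∑ k, p k ^ 2 = 1) (hq1 : ∑ k, q k ^ 2 = 1) : Contr (mixC S s p q) := by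
  intro v
  simp only [mixC_mulVec]
  set c := ∑ k, q k * v k with hc
  have hcs : c ^ 2 ≤ ∑ k, (if k ∈ S then v k ^ 2 else 0) := by
    have h1 := Finset.sum_mul_sq_le_sq_mul_sq Finset.univ q (fun k => if k ∈ S then v k else 0)
    rw [hq1, one_mul] at h1
    have h2 : ∑ k, q k * (if k ∈ S then v k else 0) = c := by
      apply Finset.sum_congr rfl
      intro k _
      by_cases hk : k ∈ S
      · simp [hk]
      · simp [hk, hq k hk]
    rw [h2] at h1
    refine h1.trans (le_of_eq ?_)
    apply Finset.sum_congr rfl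
    intro k _
    split_ifs <;> simp
  have hpt : ∀ k, ((if k ∈ S then s else 1) * v k + (1 - s) * (p k * c)) ^ 2 ≤
      v k ^ 2 - (1 - s) * (if k ∈ S then v k ^ 2 else 0) + (1 - s) * c ^ 2 * p k ^ 2 := by
    intro k
    by_cases hk : k ∈ S
    · simp only [hk, if_true]
      nlinarith [mul_nonneg (mul_nonneg hs0 (sub_nonneg.2 hs1)) (sq_nonneg (v k - p k * c))]
    · simp [hk, hp k hk]
  refine (Finset.sum_le_sum fun k _ => hpt k).trans ?_
  rw [Finset.sum_add_distrib, Finset.sum_sub_distrib, ← Finset.mul_sum, ← Finset.mul_sum, hp1]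
  nlinarith [sub_nonneg.2 hs1]

lemma relu_sum {M : Type*} [Fintype M] (z c : M → ℝ) (hc : ∀ l, 0 ≤ c l)
    (h : (∀ l, c l ≠ 0 → 0 ≤ z l) ∨ (∀ l, c l ≠ 0 → z l ≤ 0)) :
    relu (∑ l, z l * c l) = ∑ l, relu (z l) * c l := by
  unfold relu
  rcases h with h | h
  · rw [max_eq_left]
    · apply Finset.sum_congr rfl
      intro l _
      by_cases hl : c l = 0
      · simp [hl]
      · rw [max_eq_left (h l hl)]
    · apply Finset.sum_nonneg
      intro l _
      by_cases hl : c l = 0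
      · simp [hl]
      · exact mul_nonneg (h l hl) (hc l)
  · rw [max_eq_right]
    · symm
      apply Finset.sum_eq_zero
      intro l _
      by_cases hl : c l = 0
      · simp [hl]
      · rw [max_eq_right (h l hl)]; simp
    · apply Finset.sum_nonpos
      intro l _
      by_cases hl : c l = 0
      · simp [hl]
      · exact mul_nonpos_of_nonpos_of_nonneg (h l hl) (hc l)

lemma mixC_relu {N M : Type*} [Fintype M] [DecidableEq M] (S : Finset M) (s : ℝ)
    (p q : M → ℝ) (hs0 : 0 ≤ s) (hs1 : s ≤ 1)
    (hp : ∀ k, k ∉ S → p k = 0) (hq : ∀ k, k ∉ S → q k = 0)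
    (hp0 : ∀ k, 0 ≤ p k) (hq0 : ∀ k, 0 ≤ q k)
    (Z : Matrix N M ℝ) (hZ : ∀ r, (∀ k ∈ S, 0 ≤ Z r k) ∨ (∀ k ∈ S, Z r k ≤ 0)) :
    (Z * mixC S s p q).map relu = Z.map relu * mixC S s p q := by
  ext r k
  simp only [Matrix.map_apply, Matrix.mul_apply]
  apply relu_sum (Z r) (fun l => mixC S s p q l k)
  · intro l
    have : 0 ≤ (1 - s) * (p l * q k) :=
      mul_nonneg (sub_nonneg.2 hs1) (mul_nonneg (hp0 l) (hq0 k))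
    simp only [mixC]
    split_ifs <;> linarith
  · by_cases hk : k ∈ S
    · have key : ∀ l, mixC S s p q l k ≠ 0 → l ∈ S := by
        intro l hl
        by_contra hlS
        apply hl
        have : l ≠ k := fun h => hlS (h ▸ hk)
        simp [mixC, this, hp l hlS]
      rcases hZ r with h | h
      · exact Or.inl fun l hl => h l (key l hl)
      · exact Or.inr fun l hl => h l (key l hl)
    · have key : ∀ l, mixC S s p q l k ≠ 0 → l = k := by
        intro l hl
        by_contra hlk
        apply hl
        simp [mixC, hlk, hq k hk]
      rcases le_total 0 (Z r k) with h | h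
      · exact Or.inl fun l hl => by rw [key l hl]; exact h
      · exact Or.inr fun l hl => by rw [key l hl]; exact h

lemma mix_mem {N D M : Type*} [Fintype N] [Fintype D] [Fintype M] [DecidableEq M]
    (X : Matrix N D ℝ) (y : N → ℝ) (R : Matrix D M ℝ → ℝ) (lam : ℝ)
    (hR : ∀ W C, Contr C → Contr C.transpose → R (W * C) ≤ R W)
    (W : Matrix D M ℝ) (S : Finset M) (s ρ : ℝ) (p q β : M → ℝ)
    (hs0 : 0 ≤ s) (hs1 : s ≤ 1) (hp : ∀ k, k ∉ S → p k = 0) (hq : ∀ k, k ∉ S → q k = 0)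
    (hp0 : ∀ k, 0 ≤ p k) (hq0 : ∀ k, 0 ≤ q k)
    (hp1 : ∑ k, p k ^ 2 = 1) (hq1 : ∑ k, q k ^ 2 = 1)
    (hβ : ∀ k ∈ S, β k = 0) (hsq : s = 0 ∨ q = p)
    (hZ : ∀ r, (∀ k ∈ S, 0 ≤ (X * W) r k) ∨ (∀ k ∈ S, (X * W) r k ≤ 0))
    (hA : (W, fun k => β k + ρ * p k) ∈ solSet X y R l2norm lam) :
    (W * mixC S s p q, fun k => β k + ρ * q k) ∈ solSet X y R l2norm lam := by
  obtain ⟨h1, h2, h3⟩ := hA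
  have hsq' : ∀ q' : M → ℝ, (∀ k, k ∉ S → q' k = 0) → ∑ k, q' k ^ 2 = 1 →
      ∑ k, (β k + ρ * q' k) ^ 2 = ∑ k, β k ^ 2 + ρ ^ 2 := by
    intro q' hq' hq1'
    rw [← mul_one (ρ ^ 2), ← hq1', Finset.mul_sum, ← Finset.sum_add_distrib]
    apply Finset.sum_congr rfl
    intro k _
    by_cases hk : k ∈ S
    · rw [hβ k hk]; ring
    · rw [hq' k hk]; ring
  refine ⟨?_, ?_, ?_⟩
  · rw [← h1]
    simp only [nnOut]
    rw [← Matrix.mul_assoc, mixC_relu S s p q hs0 hs1 hp hq hp0 hq0 _ hZ, ← Matrix.mulVec_mulVec]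
    congr 1
    ext l
    rw [mixC_mulVec]
    have : ∑ k, q k * (β k + ρ * q k) = ρ := by
      have h4 : ∑ k, q k * (β k + ρ * q k) = ∑ k, ρ * q k ^ 2 := by
        apply Finset.sum_congr rfl
        intro k _
        by_cases hk : k ∈ S
        · rw [hβ k hk]; ring
        · rw [hq k hk]; ring
      rw [h4, ← Finset.mul_sum, hq1, mul_one]
    rw [this]
    by_cases hl : l ∈ S
    · rcases hsq with h | h
      · simp [hl, hβ l hl, h, mul_comm]
      · simp [hl, hβ l hl, h]; ring
    · simp [hl, hq l hl, hp l hl]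
  · refine (hR W _ (mixC_contr S s p q hs0 hs1 hp hq hp1 hq1) ?_).trans h2
    rw [mixC_transpose]
    exact mixC_contr S s q p hs0 hs1 hq hp hq1 hp1
  · refine le_trans (le_of_eq ?_) h3
    simp only [l2norm]
    rw [hsq' q hq hq1, hsq' p hp hp1]

lemma mix_joined {N D M : Type*} [Fintype N] [Fintype D] [Fintype M] [DecidableEq M]
    (X : Matrix N D ℝ) (y : N → ℝ) (R : Matrix D M ℝ → ℝ) (lam : ℝ)
    (hR : ∀ W C, Contr C → Contr C.transpose → R (W * C) ≤ R W)
    (W : Matrix D M ℝ) (S : Finset M) (ρ : ℝ) (β : M → ℝ) (q : ℝ → M → ℝ) (hqc : Continuous q)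
    (hq : ∀ t ∈ Set.Icc (0:ℝ) 1, ∀ k, k ∉ S → q t k = 0)
    (hq0 : ∀ t ∈ Set.Icc (0:ℝ) 1, ∀ k, 0 ≤ q t k)
    (hq1 : ∀ t ∈ Set.Icc (0:ℝ) 1, ∑ k, q t k ^ 2 = 1)
    (hβ : ∀ k ∈ S, β k = 0)
    (hZ : ∀ r, (∀ k ∈ S, 0 ≤ (X * W) r k) ∨ (∀ k ∈ S, (X * W) r k ≤ 0))
    (hA : (W, fun k => β k + ρ * q 0 k) ∈ solSet X y R l2norm lam) :
    JoinedIn (solSet X y R l2norm lam) (W, fun k => β k + ρ * q 0 k)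
      (W * mixC S 0 (q 0) (q 1), fun k => β k + ρ * q 1 k) := by
  have h0 : (0:ℝ) ∈ Set.Icc (0:ℝ) 1 := by simp
  have j1 : JoinedIn (solSet X y R l2norm lam) (W, fun k => β k + ρ * q 0 k)
      (W * mixC S 0 (q 0) (q 0), fun k => β k + ρ * q 0 k) := by
    apply JoinedIn.ofLine (f := fun t => (W * mixC S (1 - t) (q 0) (q 0), fun k => β k + ρ * q 0 k))
    · apply Continuous.continuousOn
      refine Continuous.prodMk (Continuous.matrix_mul continuous_const ?_) continuous_const
      refine continuous_matrix fun l k => ?_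
      simp only [mixC]
      split_ifs <;> fun_prop
    · have : mixC S (1 - 0) (q 0) (q 0) = 1 := by
        ext l k
        simp [mixC, Matrix.one_apply]
      simp only [this, Matrix.mul_one]
    · simp
    · rintro _ ⟨t, ht, rfl⟩
      exact mix_mem X y R lam hR W S _ ρ _ _ β (by linarith [ht.2]) (by linarith [ht.1])
        (hq 0 h0) (hq 0 h0) (hq0 0 h0) (hq0 0 h0) (hq1 0 h0) (hq1 0 h0) hβ (Or.inr rfl) hZ hA
  refine j1.trans ?_
  apply JoinedIn.ofLine (f := fun t => (W * mixC S 0 (q 0) (q t), fun k => β k + ρ * q t k))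
  · apply Continuous.continuousOn
    refine Continuous.prodMk (Continuous.matrix_mul continuous_const ?_) (by fun_prop)
    refine continuous_matrix fun l k => ?_
    simp only [mixC]
    fun_prop
  · rfl
  · rfl
  · rintro _ ⟨t, ht, rfl⟩
    exact mix_mem X y R lam hR W S _ ρ _ _ β le_rfl zero_le_one
        (hq 0 h0) (hq t ht) (hq0 0 h0) (hq0 t ht) (hq1 0 h0) (hq1 t ht) hβ (Or.inl rfl) hZ hA

lemma remove_joined {N D M : Type*} [Fintype N] [Fintype D] [Fintype M] [DecidableEq M]
    (X : Matrix N D ℝ) (y : N → ℝ) (R : Matrix D M ℝ → ℝ) (lam : ℝ)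
    (hR : ∀ W C, Contr C → Contr C.transpose → R (W * C) ≤ R W)
    (A : Matrix D M ℝ × (M → ℝ)) (hA : A ∈ solSet X y R l2norm lam) :
    ∃ B ∈ solSet X y R l2norm lam, JoinedIn (solSet X y R l2norm lam) A B ∧ removedInactive B ∧
      ∀ k, B.2 k • mcol B.1 k ≠ 0 → A.2 k • mcol A.1 k ≠ 0 := by
  classical
  obtain ⟨W, a⟩ := A
  set e : ℝ → M → ℝ := fun t k => if a k • mcol W k = 0 then 1 - t else 1 with he
  have e1 : ∀ t k, a k • mcol W k = 0 → e t k = 1 - t := fun t k h => if_pos h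
  have e2 : ∀ t k, ¬ a k • mcol W k = 0 → e t k = 1 := fun t k h => if_neg h
  have hec : Continuous e := by
    refine continuous_pi fun k => ?_
    simp only [he]
    split_ifs <;> fun_prop
  have hE : ∀ t ∈ Set.Icc (0:ℝ) 1, ∀ k, 0 ≤ e t k ∧ e t k ≤ 1 := by
    intro t ht k
    simp only [he]
    split_ifs <;> constructor <;> linarith [ht.1, ht.2]
  set f : ℝ → Matrix D M ℝ × (M → ℝ) := fun t => (W * Matrix.diagonal (e t), fun k => e t k * a k)
    with hf
  have hsq : ∀ t ∈ Set.Icc (0:ℝ) 1, ∀ v : M → ℝ, ∑ k, (e t k * v k) ^ 2 ≤ ∑ k, v k ^ 2 := by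
    intro t ht v
    apply Finset.sum_le_sum
    intro k _
    rw [mul_pow]
    have := hE t ht k
    have h2 : e t k ^ 2 ≤ 1 := pow_le_one₀ this.1 this.2
    nlinarith [sq_nonneg (v k)]
  have hmem : ∀ t ∈ Set.Icc (0:ℝ) 1, f t ∈ solSet X y R l2norm lam := by
    intro t ht
    obtain ⟨h1, h2, h3⟩ := hA
    have hcon : Contr (Matrix.diagonal (e t)) := by
      intro v
      simp only [Matrix.mulVec_diagonal]
      exact hsq t ht v
    refine ⟨?_, ?_, ?_⟩
    · rw [← h1]
      ext r
      simp only [nnOut, hf, Matrix.mulVec, dotProduct, ← Matrix.mul_assoc, Matrix.map_apply,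
        Matrix.mul_diagonal]
      apply Finset.sum_congr rfl
      intro k _
      by_cases hk : a k • mcol W k = 0
      · rcases smul_eq_zero.1 hk with h | h
        · simp [h]
        · have : (X * W) r k = 0 := by
            rw [Matrix.mul_apply]
            apply Finset.sum_eq_zero
            intro x _
            have : W x k = 0 := congrFun h x
            simp [this]
          simp [this, relu]
      · rw [e2 t k hk]; simp
    · exact (hR W _ hcon (by rw [Matrix.diagonal_transpose]; exact hcon)).trans h2
    · exact (Real.sqrt_le_sqrt (hsq t ht a)).trans h3
  have hcol : ∀ k, mcol (f 1).1 k = e 1 k • mcol W k := by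
    intro k
    ext r
    simp [hf, mcol, Matrix.mul_diagonal, mul_comm]
  refine ⟨f 1, hmem 1 (by simp), ?_, ?_, ?_⟩
  · apply JoinedIn.ofLine (f := f)
    · apply Continuous.continuousOn
      exact Continuous.prodMk (Continuous.matrix_mul continuous_const
        (Continuous.matrix_diagonal hec)) (by fun_prop)
    · simp [hf, he]
    · rfl
    · rintro _ ⟨t, ht, rfl⟩
      exact hmem t ht
  · intro k hk
    rw [hcol] at hk ⊢
    by_cases h : a k • mcol W k = 0
    · simp [hf, e1 1 k h]
    · exfalso
      apply h
      simpa only [hf, e2 1 k h, one_mul, one_smul] using hk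
  · intro k hk h
    apply hk
    rw [hcol]
    have h : a k • mcol W k = 0 := h
    simp [e1 1 k h]

lemma merge_joined {N D M : Type*} [Fintype N] [Fintype D] [Fintype M] [DecidableEq M]
    (X : Matrix N D ℝ) (y : N → ℝ) (R : Matrix D M ℝ → ℝ) (lam : ℝ)
    (hR : ∀ W C, Contr C → Contr C.transpose → R (W * C) ≤ R W)
    (A : Matrix D M ℝ × (M → ℝ)) (hA : A ∈ solSet X y R l2norm lam) (i j : M) (hij : i ≠ j)
    (hi : A.2 i • mcol A.1 i ≠ 0)
    (hpat : pattern X (mcol A.1 i) = pattern X (mcol A.1 j))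
    (hsgn : (0 ≤ A.2 i) ↔ (0 ≤ A.2 j)) :
    ∃ B ∈ solSet X y R l2norm lam, JoinedIn (solSet X y R l2norm lam) A B ∧
      B.2 j • mcol B.1 j = 0 ∧
      ∀ k, B.2 k • mcol B.1 k ≠ 0 → k = i ∨ A.2 k • mcol A.1 k ≠ 0 := by
  obtain ⟨W, a⟩ := A
  simp only at hi hpat hsgn
  have hai : a i ≠ 0 := fun h => hi (by simp [h])
  set r := Real.sqrt (a i ^ 2 + a j ^ 2) with hr
  have hpos : 0 < a i ^ 2 + a j ^ 2 := by positivity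
  have hr0 : 0 < r := Real.sqrt_pos.2 hpos
  have hr2 : r ^ 2 = a i ^ 2 + a j ^ 2 := Real.sq_sqrt hpos.le
  obtain ⟨σ, hσi, hσj⟩ : ∃ σ : ℝ, σ * |a i| = a i ∧ σ * |a j| = a j := by
    by_cases h : 0 ≤ a i
    · exact ⟨1, by rw [abs_of_nonneg h, one_mul], by rw [abs_of_nonneg (hsgn.1 h), one_mul]⟩
    · have h' : ¬ 0 ≤ a j := fun hh => h (hsgn.2 hh)
      push Not at h h'
      exact ⟨-1, by rw [abs_of_neg h]; ring, by rw [abs_of_neg h']; ring⟩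
  set q : ℝ → M → ℝ := fun t k => if k = i then Real.sqrt (a i ^ 2 + t * a j ^ 2) / r else
    if k = j then Real.sqrt (1 - t) * |a j| / r else 0 with hq
  set β : M → ℝ := fun k => if k = i then 0 else if k = j then 0 else a k with hβ
  have ha : a = fun k => β k + (σ * r) * q 0 k := by
    ext k
    by_cases hki : k = i
    · subst hki
      simp only [hβ, hq, if_true, zero_mul, add_zero, Real.sqrt_sq_eq_abs]
      field_simp
      linarith
    · by_cases hkj : k = j
      · subst hkj
        simp only [hβ, hq, hki, if_true, if_false, sub_zero, Real.sqrt_one]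
        field_simp
        linarith
      · simp [hβ, hq, hki, hkj]
  have hA' : (W, fun k => β k + (σ * r) * q 0 k) ∈ solSet X y R l2norm lam := by
    rw [← ha]; exact hA
  have hS : ∀ k, k ∉ ({i, j} : Finset M) → k ≠ i ∧ k ≠ j := by
    intro k hk
    simpa using hk
  have hqS : ∀ t, ∀ k, k ∉ ({i, j} : Finset M) → q t k = 0 := by
    intro t k hk
    simp [hq, hS k hk]
  have hJ := mix_joined X y R lam hR W {i, j} (σ * r) β q ?_ ?_ ?_ ?_ ?_ ?_ hA'
  · refine ⟨_, hJ.target_mem, ?_, ?_, ?_⟩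
    · rw [← ha] at hJ; exact hJ
    · have : β j + σ * r * q 1 j = 0 := by
        simp [hβ, hq, hij.symm]
      simp [this]
    · intro k hk
      by_contra hcon
      push Not at hcon
      obtain ⟨hki, hk0⟩ := hcon
      apply hk
      by_cases hkj : k = j
      · subst hkj
        simp [hβ, hq, hki]
      · have h1 : k ∉ ({i, j} : Finset M) := by simp [hki, hkj]
        have h2 : mcol (W * mixC {i, j} 0 (q 0) (q 1)) k = mcol W k := by
          ext x
          simp [mcol, Matrix.mul_apply, mixC, hqS 1 k h1, mul_ite, hki, hkj]
        have h3 : β k + σ * r * q 1 k = a k := by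
          simp [hβ, hq, hki, hkj]
        simp only [h2, h3]
        exact hk0
  · refine continuous_pi fun k => ?_
    simp only [hq]
    split_ifs <;> fun_prop
  · exact fun t _ => hqS t
  · intro t _ k
    simp only [hq]
    split_ifs <;> positivity
  · intro t ht
    have h1 : ∑ k, q t k ^ 2 = q t i ^ 2 + q t j ^ 2 := by
      rw [← Finset.sum_pair (f := fun k => q t k ^ 2) hij]
      symm
      apply Finset.sum_subset (Finset.subset_univ _)
      intro k _ hk
      rw [hqS t k hk]; simp
    rw [h1]
    simp only [hq, if_true, hij.symm, if_false]
    have ht0 := ht.1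
    rw [div_pow, div_pow, mul_pow, Real.sq_sqrt (show 0 ≤ a i ^ 2 + t * a j ^ 2 by positivity),
      Real.sq_sqrt (show 0 ≤ 1 - t by linarith [ht.2]), sq_abs, hr2]
    field_simp
    ring
  · intro k hk
    simp only [Finset.mem_insert, Finset.mem_singleton] at hk
    rcases hk with h | h <;> simp [hβ, h]
  · intro x
    have h := congrFun hpat x
    simp only [pattern, decide_eq_decide] at h
    have e : ∀ k, X.mulVec (mcol W k) x = (X * W) x k := by
      intro k
      simp [Matrix.mulVec, dotProduct, Matrix.mul_apply, mcol]
    rw [e, e] at h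
    simp only [Finset.mem_insert, Finset.mem_singleton, forall_eq_or_imp, forall_eq]
    by_cases h0 : 0 ≤ (X * W) x i
    · exact Or.inl ⟨h0, h.1 h0⟩
    · refine Or.inr ⟨(not_le.1 h0).le, (not_le.1 fun hh => h0 (h.2 hh)).le⟩

/-- every regularized solution is connected by a continuous path in
`O_R(λ)` to a non-mergeable solution, for `R ∈ {Frobenius, operator}`. -/
theorem path_to_nonMergeable {n d m : ℕ}
    (X : Matrix (Fin n) (Fin d) ℝ) (y : Fin n → ℝ)
    (lam : ℝ) (hlam : 0 < lam)
    (R : Matrix (Fin d) (Fin m) ℝ → ℝ) (Rv : (Fin m → ℝ) → ℝ)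
    (hR : (R = frobNorm ∧ Rv = l2norm) ∨ (R = opNorm ∧ Rv = l2norm)) :
    ∀ A ∈ solSet X y R Rv lam, ∃ B ∈ nonMergeable X y R Rv lam,
      JoinedIn (solSet X y R Rv lam) A B := by
  classical
  have hRv : Rv = l2norm := by rcases hR with h | h <;> exact h.2
  have hRR : ∀ W C, Contr C → Contr C.transpose → R (W * C) ≤ R W := by
    intro W C h1 h2
    rcases hR with h | h
    · rw [h.1]; exact frob_mul_le W C h2
    · rw [h.1]; exact op_mul_le W C h1
  subst hRv
  have main : ∀ c : ℕ, ∀ A ∈ solSet X y R l2norm lam,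
      (Finset.univ.filter fun k => A.2 k • mcol A.1 k ≠ 0).card = c →
      ∃ B ∈ nonMergeable X y R l2norm lam, JoinedIn (solSet X y R l2norm lam) A B := by
    intro c
    induction c using Nat.strong_induction_on with
    | _ c ih =>
      intro A hA hc
      obtain ⟨B, hB, hAB, hrem, hact⟩ := remove_joined X y R lam hRR A hA
      by_cases hnm : ∀ i j : Fin m, i ≠ j → B.2 i • mcol B.1 i ≠ 0 → B.2 j • mcol B.1 j ≠ 0 →
          pattern X (mcol B.1 i) ≠ pattern X (mcol B.1 j) ∨ ¬((0 ≤ B.2 i) ↔ (0 ≤ B.2 j))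
      · exact ⟨B, ⟨hB, hrem, hnm⟩, hAB⟩
      · push Not at hnm
        obtain ⟨i, j, hij, hi, hj, hpat, hsgn⟩ := hnm
        have hsgn' : (0 ≤ B.2 i) ↔ (0 ≤ B.2 j) := by tauto
        obtain ⟨E, hE, hBE, hEj, hEact⟩ :=
          merge_joined X y R lam hRR B hB i j hij hi hpat hsgn'
        have hlt : (Finset.univ.filter fun k => E.2 k • mcol E.1 k ≠ 0).card < c := by
          rw [← hc]
          apply Finset.card_lt_card
          rw [Finset.ssubset_iff_of_subset]
          · exact ⟨j, by simpa using hact j hj, fun h => (Finset.mem_filter.1 h).2 hEj⟩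
          · intro k hk
            rw [Finset.mem_filter] at hk ⊢
            refine ⟨Finset.mem_univ _, hact k ?_⟩
            rcases hEact k hk.2 with h | h
            · rw [h]; exact hi
            · exact h
        obtain ⟨F, hF, hEF⟩ := ih _ hlt E hE rfl
        exact ⟨F, hF, (hAB.trans hBE).trans hEF⟩
  intro A hA
  exact main _ A hA rfl
end

section
/- Assume Z ≠ ∅, let S = ∪_{(t,s) ∈ Z_A} O^{eq}_{‖·‖_max,(t,s)}(λ), and let m* = 2 · max_{(t,s) ∈ Z_A} Σ_{i=1}^P (t_i + s_i). If the width satisfies m ≥ m*, then for every A ∈ O_{‖·‖_max}(λ) there exists a continuous path γ : [0,1] → O_{‖·‖_max}(λ) with γ(0) = A and γ(1) ∈ S. -/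
open scoped BigOperators

/-- The equalized solution set `O^{eq}_{‖·‖_max}(λ)`. -/
def eqSet {n d m : ℕ} (X : Matrix (Fin n) (Fin d) ℝ) (y : Fin n → ℝ) (lam : ℝ) :
    Set (Matrix (Fin d) (Fin m) ℝ × (Fin m → ℝ)) :=
  {p ∈ solSet X y maxNorm linfNorm lam | removedInactive p ∧
    (∀ i, p.2 i = 0 ∨ p.2 i = 1 / lam ∨ p.2 i = -(1 / lam)) ∧
    ∀ i j : Fin m, i ≠ j → pattern X (mcol p.1 i) = pattern X (mcol p.1 j) →
      p.2 i = p.2 j → mcol p.1 i = mcol p.1 j}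

/-- The `(t, s)`-equalized solution set `O^{eq}_{‖·‖_max,(t,s)}(λ)`, relative to an
enumeration `D` of the hyperplane arrangement patterns. -/
def tsEqSet {n d m P : ℕ} (X : Matrix (Fin n) (Fin d) ℝ) (y : Fin n → ℝ) (lam : ℝ)
    (D : Fin P → (Fin n → Bool)) (t s : Fin P → ℕ) :
    Set (Matrix (Fin d) (Fin m) ℝ × (Fin m → ℝ)) :=
  {p ∈ eqSet X y lam | ∀ pp : Fin P,
     Set.ncard {i : Fin m | pattern X (mcol p.1 i) = D pp ∧ 0 < p.2 i} = t pp ∧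
     Set.ncard {i : Fin m | pattern X (mcol p.1 i) = D pp ∧ p.2 i < 0} = s pp}

/-- The convexified `(t, s)`-solution set `P_{(t,s)}`. -/
def convexSet {n d P : ℕ} (X : Matrix (Fin n) (Fin d) ℝ) (y : Fin n → ℝ) (lam : ℝ)
    (D : Fin P → (Fin n → Bool)) (t s : Fin P → ℕ) :
    Set ((Fin P → (Fin d → ℝ)) × (Fin P → (Fin d → ℝ))) :=
  {uv | (fun r => ∑ i, if D i r then X.mulVec (uv.1 i - uv.2 i) r else 0) = y ∧
    ∀ i : Fin P,
      linfNorm (uv.1 i) ≤ (t i : ℝ) / lam ^ 2 ∧ linfNorm (uv.2 i) ≤ (s i : ℝ) / lam ^ 2 ∧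
      (uv.1 i ≠ 0 → pattern X (uv.1 i) = D i) ∧ (uv.2 i ≠ 0 → pattern X (uv.2 i) = D i)}

/-- `Z = {(t, s) : P_{(t,s)} ≠ ∅}`. -/
def Zset {n d P : ℕ} (X : Matrix (Fin n) (Fin d) ℝ) (y : Fin n → ℝ) (lam : ℝ)
    (D : Fin P → (Fin n → Bool)) : Set ((Fin P → ℕ) × (Fin P → ℕ)) :=
  {ts | (convexSet X y lam D ts.1 ts.2).Nonempty}

lemma maxNorm_le_iff' {d m : ℕ} (W : Matrix (Fin d) (Fin m) ℝ) {c : ℝ} (hc : 0 ≤ c) :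
    maxNorm W ≤ c ↔ ∀ i j, |W i j| ≤ c := by
  constructor
  · intro h i j
    have h1 : |W i j| ≤ ⨆ j, |W i j| :=
      le_ciSup (f := fun j => |W i j|) (Set.finite_range _).bddAbove j
    have h2 : (⨆ j, |W i j|) ≤ maxNorm W :=
      le_ciSup (f := fun i => ⨆ j, |W i j|) (Set.finite_range _).bddAbove i
    linarith
  · intro h
    exact Real.iSup_le (fun i => Real.iSup_le (fun j => h i j) hc) hc

lemma linfNorm_le_iff' {m : ℕ} (v : Fin m → ℝ) {c : ℝ} (hc : 0 ≤ c) :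
    linfNorm v ≤ c ↔ ∀ i, |v i| ≤ c := by
  constructor
  · intro h i
    have h1 : |v i| ≤ linfNorm v :=
      le_ciSup (f := fun j => |v j|) (Set.finite_range _).bddAbove i
    linarith
  · intro h
    exact Real.iSup_le h hc

lemma nnOut_apply' {n d m : ℕ} (X : Matrix (Fin n) (Fin d) ℝ) (W : Matrix (Fin d) (Fin m) ℝ)
    (a : Fin m → ℝ) (r : Fin n) :
    nnOut X W a r = ∑ i, a i * relu (X.mulVec (mcol W i) r) := by
  simp only [nnOut, Matrix.mulVec, dotProduct, Matrix.map_apply, Matrix.mul_apply, mcol]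
  exact Finset.sum_congr rfl fun i _ => mul_comm _ _

lemma mem_sol' {n d m : ℕ} (X : Matrix (Fin n) (Fin d) ℝ) (y : Fin n → ℝ) {lam : ℝ}
    (hlam : 0 < lam) (W : Matrix (Fin d) (Fin m) ℝ) (a : Fin m → ℝ) :
    (W, a) ∈ solSet X y maxNorm linfNorm lam ↔
      (∀ r, ∑ i, a i * relu (X.mulVec (mcol W i) r) = y r) ∧
      (∀ i j, |W i j| ≤ 1 / lam) ∧ ∀ i, |a i| ≤ 1 / lam := by
  have hc : 0 ≤ 1 / lam := by positivity
  simp only [solSet, Set.mem_ofPred_eq, maxNorm_le_iff' W hc, linfNorm_le_iff' a hc, funext_iff,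
    nnOut_apply']

lemma joinedIn_of_path' {E : Type*} [TopologicalSpace E] {F : Set E} (f : ℝ → E) {A B : E}
    (hf : ContinuousOn f (Set.Icc 0 1)) (h0 : f 0 = A) (h1 : f 1 = B)
    (hm : ∀ t, 0 ≤ t → t ≤ 1 → f t ∈ F) : JoinedIn F A B :=
  JoinedIn.ofLine hf h0 h1 (by rintro _ ⟨t, ht, rfl⟩; exact hm t ht.1 ht.2)

lemma abs_conv' {a b c t : ℝ} (ha : |a| ≤ c) (hb : |b| ≤ c) (h0 : 0 ≤ t) (h1 : t ≤ 1) :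
    |(1 - t) * a + t * b| ≤ c := by
  rw [abs_le] at *
  constructor <;> nlinarith

lemma relu_conv' {x x' t : ℝ} (h : (0 ≤ x ∧ 0 ≤ x') ∨ (x ≤ 0 ∧ x' ≤ 0)) (h0 : 0 ≤ t)
    (h1 : t ≤ 1) : relu ((1 - t) * x + t * x') = (1 - t) * relu x + t * relu x' := by
  unfold relu
  rcases h with ⟨a, b⟩ | ⟨a, b⟩
  · rw [max_eq_left a, max_eq_left b, max_eq_left]; nlinarith
  · rw [max_eq_right a, max_eq_right b, max_eq_right] <;> nlinarith

lemma relu_mul' {c x : ℝ} (hc : 0 ≤ c) : relu (c * x) = c * relu x := by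
  unfold relu
  rw [mul_max_of_nonneg _ _ hc, mul_zero]

/-- Moving the first layer along a segment. -/
lemma joined_W' {n d m : ℕ} (X : Matrix (Fin n) (Fin d) ℝ) (y : Fin n → ℝ) {lam : ℝ}
    (hlam : 0 < lam) (W W' : Matrix (Fin d) (Fin m) ℝ) (a : Fin m → ℝ)
    (h : (W, a) ∈ solSet X y maxNorm linfNorm lam)
    (h' : (W', a) ∈ solSet X y maxNorm linfNorm lam)
    (hs : ∀ i r, (0 ≤ X.mulVec (mcol W i) r ∧ 0 ≤ X.mulVec (mcol W' i) r) ∨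
      (X.mulVec (mcol W i) r ≤ 0 ∧ X.mulVec (mcol W' i) r ≤ 0) ∨ a i = 0) :
    JoinedIn (solSet X y maxNorm linfNorm lam) (W, a) (W', a) := by
  refine joinedIn_of_path' (fun t : ℝ => ((1 - t) • W + t • W', a)) ?_ (by simp) (by simp) ?_
  · apply Continuous.continuousOn
    fun_prop
  · intro t h0 h1
    rw [mem_sol' X y hlam] at *
    refine ⟨fun r => ?_, fun i j => ?_, h.2.2⟩
    · have e : y r = (1 - t) * y r + t * y r := by ring
      rw [e]
      nth_rw 1 [← h.1 r]
      rw [← h'.1 r, Finset.mul_sum, Finset.mul_sum, ← Finset.sum_add_distrib]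
      refine Finset.sum_congr rfl fun i _ => ?_
      have e2 : mcol ((1 - t) • W + t • W') i = (1 - t) • mcol W i + t • mcol W' i := by
        ext k; simp [mcol]
      rw [e2, Matrix.mulVec_add, Matrix.mulVec_smul, Matrix.mulVec_smul]
      simp only [Pi.add_apply, Pi.smul_apply, smul_eq_mul]
      rcases hs i r with q | q | q
      · rw [relu_conv' (Or.inl q) h0 h1]; ring
      · rw [relu_conv' (Or.inr q) h0 h1]; ring
      · simp [q]
    · simpa using abs_conv' (h.2.1 i j) (h'.2.1 i j) h0 h1

/-- Moving the second layer along a segment. -/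
lemma joined_a' {n d m : ℕ} (X : Matrix (Fin n) (Fin d) ℝ) (y : Fin n → ℝ) {lam : ℝ}
    (hlam : 0 < lam) (W : Matrix (Fin d) (Fin m) ℝ) (a a' : Fin m → ℝ)
    (h : (W, a) ∈ solSet X y maxNorm linfNorm lam)
    (h' : (W, a') ∈ solSet X y maxNorm linfNorm lam) :
    JoinedIn (solSet X y maxNorm linfNorm lam) (W, a) (W, a') := by
  refine joinedIn_of_path' (fun t : ℝ => (W, (1 - t) • a + t • a')) ?_ (by simp) (by simp) ?_
  · apply Continuous.continuousOn
    fun_prop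
  · intro t h0 h1
    rw [mem_sol' X y hlam] at *
    refine ⟨fun r => ?_, h.2.1, fun i => ?_⟩
    · have e : y r = (1 - t) * y r + t * y r := by ring
      rw [e]
      nth_rw 1 [← h.1 r]
      rw [← h'.1 r, Finset.mul_sum, Finset.mul_sum, ← Finset.sum_add_distrib]
      refine Finset.sum_congr rfl fun i _ => ?_
      simp only [Pi.add_apply, Pi.smul_apply, smul_eq_mul]
      ring
    · simpa using abs_conv' (h.2.2 i) (h'.2.2 i) h0 h1

/-- Rescaling every neuron so that its output weight is `0` or `±1/λ`. -/
lemma joined_scale' {n d m : ℕ} (X : Matrix (Fin n) (Fin d) ℝ) (y : Fin n → ℝ) {lam : ℝ}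
    (hlam : 0 < lam) (W : Matrix (Fin d) (Fin m) ℝ) (a : Fin m → ℝ)
    (h : (W, a) ∈ solSet X y maxNorm linfNorm lam) :
    ∃ W' a', JoinedIn (solSet X y maxNorm linfNorm lam) (W, a) (W', a') ∧
      ∀ i : Fin m, a' i = 0 ∨ a' i = 1 / lam ∨ a' i = -(1 / lam) := by
  classical
  obtain ⟨c, hc⟩ : ∃ c : Fin m → ℝ, ∀ i, c i = if a i = 0 then 1 else lam * |a i| :=
    ⟨_, fun _ => rfl⟩
  have hA := (mem_sol' X y hlam W a).1 h
  have hc0 : ∀ i, 0 < c i := by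
    intro i
    rw [hc]; split_ifs with q
    · norm_num
    · have := abs_pos.2 q
      positivity
  have hc1 : ∀ i, c i ≤ 1 := by
    intro i
    rw [hc]; split_ifs with q
    · norm_num
    · have := hA.2.2 i
      rw [le_div_iff₀ hlam] at this
      linarith
  have hca : ∀ i, |a i| ≤ c i * (1 / lam) := by
    intro i
    rw [hc]; split_ifs with q
    · rw [q]; simp; positivity
    · apply le_of_eq; field_simp
  have hr : ∀ t : ℝ, 0 ≤ t → t ≤ 1 → ∀ i, c i ≤ 1 - t + t * c i := by
    intro t h0 h1 i
    nlinarith [hc1 i]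
  refine ⟨Matrix.of fun k i => (1 - 1 + 1 * c i) * W k i, fun i => a i / (1 - 1 + 1 * c i), ?_, ?_⟩
  · refine joinedIn_of_path' (fun t : ℝ => (Matrix.of fun k i => (1 - t + t * c i) * W k i,
      fun i => a i / (1 - t + t * c i))) ?_ (by simp; rfl) rfl ?_
    · refine ContinuousOn.prodMk ?_ ?_
      · apply Continuous.continuousOn
        refine continuous_pi fun k => continuous_pi fun i => ?_
        fun_prop
      · refine continuousOn_pi.2 fun i => ?_
        refine ContinuousOn.div (by fun_prop) (by fun_prop) ?_
        intro t ht
        exact ((hc0 i).trans_le (hr t ht.1 ht.2 i)).ne'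
    · intro t h0 h1
      rw [mem_sol' X y hlam]
      refine ⟨fun r => ?_, fun k i => ?_, fun i => ?_⟩
      · rw [← hA.1 r]
        refine Finset.sum_congr rfl fun i _ => ?_
        have hp := (hc0 i).trans_le (hr t h0 h1 i)
        have e2 : mcol (Matrix.of fun k i => (1 - t + t * c i) * W k i) i =
            (1 - t + t * c i) • mcol W i := by
          ext k; simp [mcol]
        rw [e2, Matrix.mulVec_smul, Pi.smul_apply, smul_eq_mul, relu_mul' hp.le]
        field_simp
      · have hp := (hc0 i).trans_le (hr t h0 h1 i)
        have h2 : 1 - t + t * c i ≤ 1 := by nlinarith [hc1 i]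
        rw [Matrix.of_apply, abs_mul, abs_of_pos hp]
        have := hA.2.1 k i
        have h3 := abs_nonneg (W k i)
        nlinarith
      · have hp := (hc0 i).trans_le (hr t h0 h1 i)
        rw [abs_div, abs_of_pos hp, div_le_iff₀ hp, mul_comm]
        refine (hca i).trans ?_
        have := hr t h0 h1 i
        gcongr
  · intro i
    simp only [sub_self, zero_add, one_mul, hc]
    split_ifs with q
    · left; simp [q]
    · right
      rcases lt_or_gt_of_ne q with q' | q'
      · right; rw [abs_of_neg q']; field_simp
      · left; rw [abs_of_pos q']; field_simp

lemma pattern_true' {n d : ℕ} {X : Matrix (Fin n) (Fin d) ℝ} {h : Fin d → ℝ} {E : Fin n → Bool}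
    (e : pattern X h = E) {r : Fin n} (hr : E r = true) : 0 ≤ X.mulVec h r := by
  subst e; simpa [pattern] using hr

lemma pattern_false' {n d : ℕ} {X : Matrix (Fin n) (Fin d) ℝ} {h : Fin d → ℝ}
    {E : Fin n → Bool} (e : pattern X h = E) {r : Fin n} (hr : ¬ E r = true) :
    X.mulVec h r < 0 := by
  subst e; simpa [pattern] using hr

lemma pattern_eq' {n d : ℕ} {X : Matrix (Fin n) (Fin d) ℝ} {h : Fin d → ℝ}
    {E : Fin n → Bool} (h1 : ∀ r, E r = true → 0 ≤ X.mulVec h r)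
    (h2 : ∀ r, ¬ E r = true → X.mulVec h r < 0) : pattern X h = E := by
  funext r
  by_cases q : E r = true
  · simp [pattern, q, h1 r q]
  · have := h2 r q
    simp only [Bool.not_eq_true] at q
    simp [pattern, q, this]

lemma pattern_smul' {n d : ℕ} {X : Matrix (Fin n) (Fin d) ℝ} {h : Fin d → ℝ}
    {E : Fin n → Bool} {c : ℝ} (hc : 0 < c) (e : pattern X h = E) : pattern X (c • h) = E := by
  refine pattern_eq' (fun r hr => ?_) fun r hr => ?_
  · have := pattern_true' e hr
    rw [Matrix.mulVec_smul, Pi.smul_apply, smul_eq_mul]; positivity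
  · have := pattern_false' e hr
    rw [Matrix.mulVec_smul, Pi.smul_apply, smul_eq_mul]; exact mul_neg_of_pos_of_neg hc this

lemma pattern_sum' {n d m : ℕ} {X : Matrix (Fin n) (Fin d) ℝ} {w : Fin m → Fin d → ℝ}
    {E : Fin n → Bool} {s : Finset (Fin m)} (hs : s.Nonempty)
    (e : ∀ i ∈ s, pattern X (w i) = E) : pattern X (∑ i ∈ s, w i) = E := by
  have hsum : ∀ r, X.mulVec (∑ i ∈ s, w i) r = ∑ i ∈ s, X.mulVec (w i) r := by
    intro r
    rw [Matrix.mulVec_sum, Finset.sum_apply]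
  refine pattern_eq' (fun r hr => ?_) fun r hr => ?_
  · rw [hsum]; exact Finset.sum_nonneg fun i hi => pattern_true' (e i hi) hr
  · rw [hsum]; exact Finset.sum_neg (fun i hi => pattern_false' (e i hi) hr) hs

lemma relu_pattern' {n d : ℕ} {X : Matrix (Fin n) (Fin d) ℝ} {h : Fin d → ℝ}
    {E : Fin n → Bool} (e : h ≠ 0 → pattern X h = E) (r : Fin n) :
    relu (X.mulVec h r) = if E r then X.mulVec h r else 0 := by
  by_cases h0 : h = 0
  · subst h0; simp [relu]
  · have e := e h0
    split_ifs with q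
    · exact max_eq_left (pattern_true' e q)
    · exact max_eq_right (pattern_false' e q).le

/-- Output grouped by pattern. -/
lemma out_group' {n d m P : ℕ} (X : Matrix (Fin n) (Fin d) ℝ) (D : Fin P → Fin n → Bool)
    (W : Matrix (Fin d) (Fin m) ℝ) (a : Fin m → ℝ) (p : Fin m → Fin P)
    (hp : ∀ i, mcol W i ≠ 0 → pattern X (mcol W i) = D (p i)) (u v : Fin P → Fin d → ℝ)
    (huv : ∀ q, ∑ i with p i = q, a i • mcol W i = u q - v q) (r : Fin n) :
    ∑ i, a i * relu (X.mulVec (mcol W i) r) =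
      ∑ q, if D q r then X.mulVec (u q - v q) r else 0 := by
  rw [← Finset.sum_fiberwise (s := Finset.univ) (g := p)]
  refine Finset.sum_congr rfl fun q _ => ?_
  rw [← huv q, Matrix.mulVec_sum, Finset.sum_apply]
  have : ∀ i ∈ Finset.univ.filter (fun i => p i = q), a i * relu (X.mulVec (mcol W i) r) =
      if D q r then X.mulVec (a i • mcol W i) r else 0 := by
    intro i hi
    have hi := (Finset.mem_filter.1 hi).2
    rw [relu_pattern' (hp i), hi, Matrix.mulVec_smul]
    split_ifs <;> simp
  rw [Finset.sum_congr rfl this]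
  split_ifs <;> simp


lemma sum_split' {m d : ℕ} {lam : ℝ} (hlam : 0 < lam) {P : ℕ} (p : Fin m → Fin P)
    (a : Fin m → ℝ) (ha : ∀ i, a i = 0 ∨ a i = 1 / lam ∨ a i = -(1 / lam))
    (f : Fin m → Fin d → ℝ) (q : Fin P) :
    ∑ i with p i = q, a i • f i =
      ∑ i with p i = q ∧ 0 < a i, (1 / lam) • f i - ∑ i with p i = q ∧ a i < 0, (1 / lam) • f i := by
  have hl : 0 < 1 / lam := by positivity
  simp only [Finset.sum_filter]
  rw [← Finset.sum_sub_distrib]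
  refine Finset.sum_congr rfl fun i _ => ?_
  by_cases hq : p i = q
  · rcases ha i with h | h | h
    · simp [h]
    · have h1 : ¬ (1 / lam < 0) := by linarith
      rw [h]; simp only [hq, hl, h1]; simp
    · have h1 : ¬ (0 < -(1 / lam)) := by linarith
      have h2 : -(1 / lam) < 0 := by linarith
      rw [h]; simp only [hq, h1, h2]; simp
  · simp [hq]

lemma mem_convex' {n d P : ℕ} (X : Matrix (Fin n) (Fin d) ℝ) (y : Fin n → ℝ) (lam : ℝ)
    (D : Fin P → (Fin n → Bool)) (t s : Fin P → ℕ) (u v : Fin P → Fin d → ℝ) :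
    (u, v) ∈ convexSet X y lam D t s ↔
      (∀ r, (∑ i, if D i r then X.mulVec (u i - v i) r else 0) = y r) ∧
    ∀ i : Fin P,
      (∀ k, |u i k| ≤ (t i : ℝ) / lam ^ 2) ∧ (∀ k, |v i k| ≤ (s i : ℝ) / lam ^ 2) ∧
      (u i ≠ 0 → pattern X (u i) = D i) ∧ (v i ≠ 0 → pattern X (v i) = D i) := by
  have h1 : ∀ i, linfNorm (u i) ≤ (t i : ℝ) / lam ^ 2 ↔ ∀ k, |u i k| ≤ (t i : ℝ) / lam ^ 2 :=
    fun i => linfNorm_le_iff' _ (by positivity)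
  have h2 : ∀ i, linfNorm (v i) ≤ (s i : ℝ) / lam ^ 2 ↔ ∀ k, |v i k| ≤ (s i : ℝ) / lam ^ 2 :=
    fun i => linfNorm_le_iff' _ (by positivity)
  simp only [convexSet, Set.mem_ofPred_eq, h1, h2, funext_iff]

lemma sum_norm' {d m : ℕ} {lam : ℝ} (hlam : 0 < lam) (W : Matrix (Fin d) (Fin m) ℝ)
    (hW : ∀ i j, |W i j| ≤ 1 / lam) (s : Finset (Fin m)) (k : Fin d) :
    |(∑ i ∈ s, (1 / lam) • mcol W i) k| ≤ (s.card : ℝ) / lam ^ 2 := by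
  rw [Finset.sum_apply]
  refine (Finset.abs_sum_le_sum_abs _ _).trans ?_
  refine (Finset.sum_le_card_nsmul s _ (1 / lam ^ 2) ?_).trans ?_
  · intro i _
    have h0 : (0 : ℝ) < 1 / lam := by positivity
    rw [Pi.smul_apply, smul_eq_mul, abs_mul, abs_of_pos h0]
    calc 1 / lam * |W k i| ≤ 1 / lam * (1 / lam) := by
          gcongr; exact hW k i
      _ = _ := by field_simp
  · rw [nsmul_eq_mul]; apply le_of_eq; ring

lemma pattern_sum_smul' {n d m : ℕ} {X : Matrix (Fin n) (Fin d) ℝ} {lam : ℝ} (hlam : 0 < lam)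
    {w : Fin m → Fin d → ℝ}
    {E : Fin n → Bool} {s : Finset (Fin m)}
    (e : ∀ i ∈ s, pattern X (w i) = E) (hne : ∑ i ∈ s, (1 / lam) • w i ≠ 0) :
    pattern X (∑ i ∈ s, (1 / lam) • w i) = E := by
  refine pattern_sum' ?_ fun i hi => pattern_smul' (by positivity) (e i hi)
  by_contra hs
  rw [Finset.not_nonempty_iff_eq_empty] at hs
  subst hs
  simp at hne

lemma sum_const_part' {d m : ℕ} {lam : ℝ} (hlam : 0 < lam) (T K : Finset (Fin m)) (hKT : K ⊆ T)
    (f : Fin m → Fin d → ℝ) (u : Fin d → ℝ) (hu : K.card = 0 → u = 0)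
    (hK : ∀ i ∈ K, f i = (lam / (K.card : ℝ)) • u) (hT : ∀ i ∈ T, i ∉ K → f i = 0) :
    ∑ i ∈ T, (1 / lam) • f i = u := by
  rw [← Finset.sum_subset hKT (fun i hi hk => by rw [hT i hi hk, smul_zero])]
  rw [Finset.sum_congr rfl (fun i hi => by rw [hK i hi]), Finset.sum_const]
  by_cases h : K.card = 0
  · rw [hu h]; simp
  · have h' : (K.card : ℝ) ≠ 0 := by exact_mod_cast h
    ext k
    simp only [Pi.smul_apply, smul_eq_mul, nsmul_eq_mul]
    field_simp

lemma scaled_abs' {lam : ℝ} (hlam : 0 < lam) (c : ℕ) {x : ℝ} (hx : |x| ≤ (c : ℝ) / lam ^ 2) :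
    |lam / (c : ℝ) * x| ≤ 1 / lam := by
  by_cases h : c = 0
  · subst h; simp; positivity
  · have h' : (0 : ℝ) < c := by exact_mod_cast Nat.pos_of_ne_zero h
    have h2 : 0 < lam / (c : ℝ) := by positivity
    rw [abs_mul, abs_of_pos h2]
    calc lam / (c : ℝ) * |x| ≤ lam / (c : ℝ) * ((c : ℝ) / lam ^ 2) := by gcongr
      _ = _ := by field_simp


/-- if `m ≥ m* = 2·max_{(t,s) ∈ Z_A} Σᵢ (tᵢ + sᵢ)`, then every point of
`O_{‖·‖_max}(λ)` is joined by a continuous path inside `O_{‖·‖_max}(λ)` to a point of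
`S = ⋃_{(t,s) ∈ Z_A} O^{eq}_{‖·‖_max,(t,s)}(λ)`. -/
theorem path_to_equalized {n d m P : ℕ}
    (X : Matrix (Fin n) (Fin d) ℝ) (y : Fin n → ℝ)
    (lam : ℝ) (hlam : 0 < lam)
    (D : Fin P → (Fin n → Bool)) (hDinj : Function.Injective D)
    (hDrange : Set.range D = Set.range (pattern X))
    (hZ : (Zset X y lam D).Nonempty)
    (mstar : ℕ)
    (hmstar : mstar = 2 * sSup
      ((fun ts : (Fin P → ℕ) × (Fin P → ℕ) => ∑ i, (ts.1 i + ts.2 i)) ''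
        {ts | Minimal (· ∈ Zset X y lam D) ts}))
    (hm : mstar ≤ m) :
    ∀ A ∈ solSet (M := Fin m) X y maxNorm linfNorm lam,
      ∃ B ∈ ⋃ ts ∈ {ts : (Fin P → ℕ) × (Fin P → ℕ) | Minimal (· ∈ Zset X y lam D) ts},
              tsEqSet (m := m) X y lam D ts.1 ts.2,
        JoinedIn (solSet (M := Fin m) X y maxNorm linfNorm lam) A B := by
  classical
  rintro ⟨W0, a0⟩ hA
  have hl : 0 < 1 / lam := by positivity
  obtain ⟨W, a, hj, ha⟩ := joined_scale' X y hlam W0 a0 hA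
  have hS := hj.target_mem
  have hS' := (mem_sol' X y hlam W a).1 hS
  have hpe : ∀ i, ∃ q, D q = pattern X (mcol W i) := by
    intro i
    have : pattern X (mcol W i) ∈ Set.range D := by rw [hDrange]; exact ⟨_, rfl⟩
    exact this
  choose p hp using hpe
  obtain ⟨T, hT⟩ : ∃ T : Fin P → Finset (Fin m),
      ∀ q, T q = Finset.univ.filter (fun i => p i = q ∧ 0 < a i) := ⟨_, fun _ => rfl⟩
  obtain ⟨S, hSd⟩ : ∃ S : Fin P → Finset (Fin m),
      ∀ q, S q = Finset.univ.filter (fun i => p i = q ∧ a i < 0) := ⟨_, fun _ => rfl⟩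
  have memT : ∀ q i, i ∈ T q ↔ p i = q ∧ 0 < a i := by intro q i; simp [hT]
  have memS : ∀ q i, i ∈ S q ↔ p i = q ∧ a i < 0 := by intro q i; simp [hSd]
  have hsplit : ∀ (f : Fin m → Fin d → ℝ) q, ∑ i with p i = q, a i • f i =
      ∑ i ∈ T q, (1 / lam) • f i - ∑ i ∈ S q, (1 / lam) • f i := by
    intro f q
    rw [hT, hSd]; exact sum_split' hlam p a ha f q
  have hZm : ((fun q => (T q).card, fun q => (S q).card) : (Fin P → ℕ) × (Fin P → ℕ)) ∈
      Zset X y lam D := by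
    refine ⟨(fun q => ∑ i ∈ T q, (1 / lam) • mcol W i,
      fun q => ∑ i ∈ S q, (1 / lam) • mcol W i), ?_⟩
    rw [mem_convex']
    refine ⟨fun r => ?_, fun q => ⟨fun k => sum_norm' hlam W hS'.2.1 _ k,
      fun k => sum_norm' hlam W hS'.2.1 _ k, fun hne => ?_, fun hne => ?_⟩⟩
    · rw [← hS'.1 r]
      exact (out_group' X D W a p (fun i _ => (hp i).symm) _ _ (fun q => hsplit _ q) r).symm
    · refine pattern_sum_smul' hlam (fun i hi => ?_) hne
      rw [← hp i, ((memT q i).1 hi).1]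
    · refine pattern_sum_smul' hlam (fun i hi => ?_) hne
      rw [← hp i, ((memS q i).1 hi).1]
  obtain ⟨⟨t, s⟩, hle, hmin⟩ := exists_minimal_le_of_wellFoundedLT (· ∈ Zset X y lam D) _ hZm
  obtain ⟨⟨u, v⟩, huv⟩ := hmin.prop
  have huv' := (mem_convex' X y lam D t s u v).1 huv
  have htT : ∀ q, t q ≤ (T q).card := fun q => hle.1 q
  have hsS : ∀ q, s q ≤ (S q).card := fun q => hle.2 q
  have hu0 : ∀ q, t q = 0 → u q = 0 := by
    intro q hq
    ext k
    have := (huv'.2 q).1 k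
    rw [hq] at this
    simpa using this
  have hv0 : ∀ q, s q = 0 → v q = 0 := by
    intro q hq
    ext k
    have := (huv'.2 q).2.1 k
    rw [hq] at this
    simpa using this
  have hu1 : ∀ q, u q = 0 → t q = 0 := by
    intro q hq
    have hmem : ((Function.update t q 0, s) : (Fin P → ℕ) × (Fin P → ℕ)) ∈ Zset X y lam D := by
      refine ⟨(u, v), ?_⟩
      rw [mem_convex']
      refine ⟨huv'.1, fun q' => ⟨fun k => ?_, (huv'.2 q').2⟩⟩
      by_cases e : q' = q
      · subst e; simp [hq]
      · simp only [Function.update_of_ne e]; exact (huv'.2 q').1 k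
    have h2 := hmin.le_of_le hmem ⟨by intro q'; by_cases e : q' = q
                                      · subst e; simp
                                      · simp [Function.update_of_ne e], le_refl _⟩
    have h3 := h2.1 q
    simpa using h3
  have hv1 : ∀ q, v q = 0 → s q = 0 := by
    intro q hq
    have hmem : ((t, Function.update s q 0) : (Fin P → ℕ) × (Fin P → ℕ)) ∈ Zset X y lam D := by
      refine ⟨(u, v), ?_⟩
      rw [mem_convex']
      refine ⟨huv'.1, fun q' => ⟨(huv'.2 q').1, fun k => ?_, (huv'.2 q').2.2⟩⟩
      by_cases e : q' = q
      · subst e; simp [hq]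
      · simp only [Function.update_of_ne e]; exact (huv'.2 q').2.1 k
    have h2 := hmin.le_of_le hmem ⟨le_refl _, by intro q'; by_cases e : q' = q
                                                 · subst e; simp
                                                 · simp [Function.update_of_ne e]⟩
    have h3 := h2.2 q
    simpa using h3
  choose K hKT hKc using fun q => Finset.exists_subset_card_eq (htT q)
  choose L hLS hLc using fun q => Finset.exists_subset_card_eq (hsS q)
  -- basic facts about the selection
  have hKp : ∀ q i, i ∈ K q → p i = q ∧ 0 < a i := fun q i hi => (memT q i).1 (hKT q hi)
  have hLp : ∀ q i, i ∈ L q → p i = q ∧ a i < 0 := fun q i hi => (memS q i).1 (hLS q hi)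
  obtain ⟨w, hw⟩ : ∃ w : Fin m → Fin d → ℝ, ∀ i, w i =
      if i ∈ K (p i) then (lam / (t (p i) : ℝ)) • u (p i)
      else if i ∈ L (p i) then (lam / (s (p i) : ℝ)) • v (p i) else 0 := ⟨_, fun _ => rfl⟩
  obtain ⟨b, hb⟩ : ∃ b : Fin m → ℝ, ∀ i, b i =
      if i ∈ K (p i) ∨ i ∈ L (p i) then a i else 0 := ⟨_, fun _ => rfl⟩
  have hwK : ∀ i, i ∈ K (p i) → w i = (lam / (t (p i) : ℝ)) • u (p i) := by
    intro i hi; rw [hw, if_pos hi]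
  have hwL : ∀ i, i ∈ L (p i) → w i = (lam / (s (p i) : ℝ)) • v (p i) := by
    intro i hi
    have : i ∉ K (p i) := fun h => by linarith [(hKp _ _ h).2, (hLp _ _ hi).2]
    rw [hw, if_neg this, if_pos hi]
  have hw0 : ∀ i, ¬ (i ∈ K (p i) ∨ i ∈ L (p i)) → w i = 0 := by
    intro i hi
    rw [not_or] at hi
    rw [hw, if_neg hi.1, if_neg hi.2]
  have hKpos : ∀ q i, i ∈ K q → 0 < t q := by
    intro q i hi
    rw [← hKc q]; exact Finset.card_pos.2 ⟨i, hi⟩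
  have hLpos : ∀ q i, i ∈ L q → 0 < s q := by
    intro q i hi
    rw [← hLc q]; exact Finset.card_pos.2 ⟨i, hi⟩
  have hwpat : ∀ i, (i ∈ K (p i) ∨ i ∈ L (p i)) → w i ≠ 0 ∧ pattern X (w i) = D (p i) := by
    rintro i (hi | hi)
    · have h1 := hKpos _ _ hi
      have h2 : (0 : ℝ) < lam / (t (p i) : ℝ) := by
        have : (0 : ℝ) < t (p i) := by exact_mod_cast h1
        positivity
      have h3 : u (p i) ≠ 0 := fun h => h1.ne' (hu1 _ h)
      rw [hwK i hi]
      exact ⟨smul_ne_zero h2.ne' h3, pattern_smul' h2 ((huv'.2 _).2.2.1 h3)⟩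
    · have h1 := hLpos _ _ hi
      have h2 : (0 : ℝ) < lam / (s (p i) : ℝ) := by
        have : (0 : ℝ) < s (p i) := by exact_mod_cast h1
        positivity
      have h3 : v (p i) ≠ 0 := fun h => h1.ne' (hv1 _ h)
      rw [hwL i hi]
      exact ⟨smul_ne_zero h2.ne' h3, pattern_smul' h2 ((huv'.2 _).2.2.2 h3)⟩
  have hwpat' : ∀ i, w i ≠ 0 → pattern X (w i) = D (p i) := by
    intro i hi
    by_cases h : i ∈ K (p i) ∨ i ∈ L (p i)
    · exact (hwpat i h).2
    · exact absurd (hw0 i h) hi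
  obtain ⟨W', hW'⟩ : ∃ W' : Matrix (Fin d) (Fin m) ℝ, ∀ i, mcol W' i = w i :=
    ⟨Matrix.of fun k i => w i k, fun i => rfl⟩
  have hWn : ∀ k i, |W' k i| ≤ 1 / lam := by
    intro k i
    have e : W' k i = w i k := congrFun (hW' i) k
    rw [e, hw]
    split_ifs
    · exact scaled_abs' hlam _ ((huv'.2 _).1 k)
    · exact scaled_abs' hlam _ ((huv'.2 _).2.1 k)
    · simpa using hl.le
  have hgroup : ∀ q, ∑ i with p i = q, a i • mcol W' i = u q - v q := by
    intro q
    rw [hsplit]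
    congr 1
    · refine sum_const_part' hlam (T q) (K q) (hKT q) _ _ (by rw [hKc]; exact hu0 q) ?_ ?_
      · intro i hi
        have e := (hKp q i hi).1
        subst e
        rw [hW', hwK i hi, hKc]
      · intro i hi hn
        have e := (memT q i).1 hi
        rw [hW']
        refine hw0 i ?_
        rw [e.1]
        rintro (h | h)
        · exact hn h
        · linarith [(hLp q i h).2, e.2]
    · refine sum_const_part' hlam (S q) (L q) (hLS q) _ _ (by rw [hLc]; exact hv0 q) ?_ ?_
      · intro i hi
        have e := (hLp q i hi).1
        subst e
        rw [hW', hwL i hi, hLc]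
      · intro i hi hn
        have e := (memS q i).1 hi
        rw [hW']
        refine hw0 i ?_
        rw [e.1]
        rintro (h | h)
        · linarith [(hKp q i h).2, e.2]
        · exact hn h
  have hsol1 : (W', a) ∈ solSet X y maxNorm linfNorm lam := by
    rw [mem_sol' X y hlam]
    refine ⟨fun r => ?_, hWn, hS'.2.2⟩
    rw [← huv'.1 r]
    exact out_group' X D W' a p (by intro i; rw [hW']; exact hwpat' i) u v hgroup r
  have hsol2 : (W', b) ∈ solSet X y maxNorm linfNorm lam := by
    have h1 := (mem_sol' X y hlam W' a).1 hsol1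
    rw [mem_sol' X y hlam]
    refine ⟨fun r => ?_, hWn, fun i => ?_⟩
    · rw [← h1.1 r]
      refine Finset.sum_congr rfl fun i _ => ?_
      rw [hb]
      split_ifs with h
      · rfl
      · rw [hW', hw0 i h]; simp [relu]
    · rw [hb]
      split_ifs
      · exact hS'.2.2 i
      · simpa using hl.le
  have hbne : ∀ i, b i ≠ 0 ↔ (i ∈ K (p i) ∨ i ∈ L (p i)) := by
    intro i
    rw [hb]
    split_ifs with h
    · refine ⟨fun _ => h, fun _ => ?_⟩
      rcases h with h | h
      · exact (hKp _ _ h).2.ne'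
      · exact (hLp _ _ h).2.ne
    · simp [h]
  have hposK : ∀ i, 0 < b i ↔ i ∈ K (p i) := by
    intro i
    constructor
    · intro h
      have h1 := (hbne i).1 h.ne'
      rw [hb, if_pos h1] at h
      rcases h1 with h1 | h1
      · exact h1
      · linarith [(hLp _ _ h1).2]
    · intro h
      rw [hb, if_pos (Or.inl h)]; exact (hKp _ _ h).2
  have hnegL : ∀ i, b i < 0 ↔ i ∈ L (p i) := by
    intro i
    constructor
    · intro h
      have h1 := (hbne i).1 h.ne
      rw [hb, if_pos h1] at h
      rcases h1 with h1 | h1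
      · linarith [(hKp _ _ h1).2]
      · exact h1
    · intro h
      rw [hb, if_pos (Or.inr h)]; exact (hLp _ _ h).2
  refine ⟨(W', b), ?_, hj.trans ((joined_W' X y hlam W W' a hS hsol1 ?_).trans
    (joined_a' X y hlam W' a b hsol1 hsol2))⟩
  · refine Set.mem_iUnion₂.2 ⟨(t, s), hmin, ⟨hsol2, ?_, ?_, ?_⟩, ?_⟩
    · intro i hi
      simp only [hW'] at hi ⊢
      have hn : ¬ (i ∈ K (p i) ∨ i ∈ L (p i)) := fun h =>
        smul_ne_zero ((hbne i).2 h) (hwpat i h).1 hi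
      exact ⟨hw0 i hn, by_contra fun h => hn ((hbne i).1 h)⟩
    · intro i
      simp only [hb]
      split_ifs
      · exact ha i
      · exact Or.inl rfl
    · intro i j _ hpat hbe
      simp only [hW'] at hpat hbe ⊢
      rcases lt_trichotomy (b i) 0 with h | h | h
      · have hi := (hnegL i).1 h
        have hj := (hnegL j).1 (hbe ▸ h)
        have e : p i = p j := hDinj (by
          rw [← (hwpat i (Or.inr hi)).2, ← (hwpat j (Or.inr hj)).2, hpat])
        rw [hwL i hi, hwL j hj, e]
      · have hi : ¬ (i ∈ K (p i) ∨ i ∈ L (p i)) := fun q => (hbne i).2 q h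
        have hj : ¬ (j ∈ K (p j) ∨ j ∈ L (p j)) := fun q => (hbne j).2 q (hbe ▸ h)
        rw [hw0 i hi, hw0 j hj]
      · have hi := (hposK i).1 h
        have hj := (hposK j).1 (hbe ▸ h)
        have e : p i = p j := hDinj (by
          rw [← (hwpat i (Or.inl hi)).2, ← (hwpat j (Or.inl hj)).2, hpat])
        rw [hwK i hi, hwK j hj, e]
    · intro q
      simp only [hW']
      constructor
      · rw [← hKc q, ← Set.ncard_coe_finset]
        congr 1
        ext i
        simp only [Set.mem_ofPred_eq, Finset.mem_coe, hposK]
        constructor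
        · rintro ⟨h1, h2⟩
          rw [(hwpat i (Or.inl h2)).2] at h1
          rw [← hDinj h1]; exact h2
        · intro h
          have e := (hKp q i h).1
          subst e
          exact ⟨(hwpat i (Or.inl h)).2, h⟩
      · rw [← hLc q, ← Set.ncard_coe_finset]
        congr 1
        ext i
        simp only [Set.mem_ofPred_eq, Finset.mem_coe, hnegL]
        constructor
        · rintro ⟨h1, h2⟩
          rw [(hwpat i (Or.inr h2)).2] at h1
          rw [← hDinj h1]; exact h2
        · intro h
          have e := (hLp q i h).1
          subst e
          exact ⟨(hwpat i (Or.inr h)).2, h⟩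
  · intro i r
    rw [hW']
    have h1 := (hp i).symm
    by_cases h0 : w i = 0
    · rw [h0, Matrix.mulVec_zero]
      rcases le_total 0 (X.mulVec (mcol W i) r) with h | h
      · exact Or.inl ⟨h, le_refl _⟩
      · exact Or.inr (Or.inl ⟨h, le_refl _⟩)
    · have h2 := hwpat' i h0
      by_cases q : D (p i) r = true
      · exact Or.inl ⟨pattern_true' h1 q, pattern_true' h2 q⟩
      · exact Or.inr (Or.inl ⟨(pattern_false' h1 q).le, (pattern_false' h2 q).le⟩)
end

section
/- There exists a positive integer m*, depending only on (X, y, λ), such that for every width m ≥ m* and any two points A, B ∈ O_{‖·‖_max}(λ) there is a continuous path γ : [0,1] → O_{‖·‖_max}(λ) with γ(0) = A and γ(1) = B; that is, the entrywise-max-norm regularized solution set is path-connected at all sufficiently large widths. -/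
open scoped BigOperators

noncomputable def preA {n d : ℕ} (X : Matrix (Fin n) (Fin d) ℝ) (w : Fin d → ℝ) (k : Fin n) : ℝ :=
  ∑ i, X k i * w i

def Feas {n d m : ℕ} (X : Matrix (Fin n) (Fin d) ℝ) (y : Fin n → ℝ) (C : ℝ) :
    Set (Matrix (Fin d) (Fin m) ℝ × (Fin m → ℝ)) :=
  {p | (∀ k, ∑ j, relu (preA X (fun i => p.1 i j) k) * p.2 j = y k) ∧
    (∀ i j, |p.1 i j| ≤ C) ∧ ∀ j, |p.2 j| ≤ C}

lemma relu_smul {c : ℝ} (hc : 0 ≤ c) (x : ℝ) : relu (c * x) = c * relu x := by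
  unfold relu
  rw [mul_max_of_nonneg _ _ hc, mul_zero]

lemma relu_zero' : relu 0 = 0 := by simp [relu]

lemma preA_zero {n d : ℕ} (X : Matrix (Fin n) (Fin d) ℝ) (k : Fin n) :
    preA X (fun _ => 0) k = 0 := by simp [preA]

lemma preA_smul {n d : ℕ} (X : Matrix (Fin n) (Fin d) ℝ) (c : ℝ) (w : Fin d → ℝ) (k : Fin n) :
    preA X (fun i => c * w i) k = c * preA X w k := by
  simp only [preA, Finset.mul_sum]
  exact Finset.sum_congr rfl fun i _ => by ring

lemma preA_comb {n d : ℕ} (X : Matrix (Fin n) (Fin d) ℝ) (a b : ℝ) (w v : Fin d → ℝ) (k : Fin n) :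
    preA X (fun i => a * w i + b * v i) k = a * preA X w k + b * preA X v k := by
  simp only [preA, Finset.mul_sum, ← Finset.sum_add_distrib]
  exact Finset.sum_congr rfl fun i _ => by ring

lemma solSet_eq {n d m : ℕ} (X : Matrix (Fin n) (Fin d) ℝ) (y : Fin n → ℝ)
    (lam : ℝ) (hlam : 0 < lam) :
    solSet (M := Fin m) X y maxNorm linfNorm lam = Feas X y (1 / lam) := by
  have hC : 0 ≤ 1 / lam := by positivity
  ext p
  simp only [solSet, Feas, Set.mem_ofPred_eq]
  refine and_congr ?_ (and_congr ?_ ?_)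
  · rw [funext_iff]
    rfl
  · unfold maxNorm
    constructor
    · intro h i j
      refine le_trans ?_ h
      refine le_trans ?_ (le_ciSup (f := fun i => ⨆ j, |p.1 i j|) (Set.finite_range _).bddAbove i)
      exact le_ciSup (f := fun j => |p.1 i j|) (Set.finite_range _).bddAbove j
    · intro h
      exact Real.iSup_le (fun i => Real.iSup_le (fun j => h i j) hC) hC
  · unfold linfNorm
    constructor
    · intro h j
      exact le_trans (le_ciSup (f := fun j => |p.2 j|) (Set.finite_range _).bddAbove j) h
    · intro h
      exact Real.iSup_le h hC

lemma abs_comb_le {a b C t : ℝ} (ha : |a| ≤ C) (hb : |b| ≤ C) (h0 : 0 ≤ t) (h1 : t ≤ 1) :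
    |(1 - t) * a + t * b| ≤ C := by
  rw [abs_le] at *
  constructor <;> nlinarith [ha.1, ha.2, hb.1, hb.2]

lemma line_alpha {n d m : ℕ} {X : Matrix (Fin n) (Fin d) ℝ} {y : Fin n → ℝ} {C : ℝ}
    {W : Matrix (Fin d) (Fin m) ℝ} {a b : Fin m → ℝ}
    (hA : (W, a) ∈ Feas X y C) (hB : (W, b) ∈ Feas X y C) :
    JoinedIn (Feas X y C) (W, a) (W, b) := by
  refine JoinedIn.ofLine (f := fun t : ℝ => (W, fun j => (1 - t) * a j + t * b j)) ?_ ?_ ?_ ?_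
  · apply Continuous.continuousOn
    fun_prop
  · simp
  · simp
  · rintro _ ⟨t, ⟨h0, h1⟩, rfl⟩
    refine ⟨fun k => ?_, hA.2.1, fun j => abs_comb_le (hA.2.2 j) (hB.2.2 j) h0 h1⟩
    have e1 := hA.1 k
    have e2 := hB.1 k
    simp only at e1 e2 ⊢
    calc _ = (1 - t) * (∑ j, relu (preA X (fun i => W i j) k) * a j)
          + t * (∑ j, relu (preA X (fun i => W i j) k) * b j) := by
          simp only [Finset.mul_sum, ← Finset.sum_add_distrib]
          exact Finset.sum_congr rfl fun i _ => by ring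
      _ = y k := by rw [e1, e2]; ring

lemma relu_comb {p q t : ℝ} (h0 : 0 ≤ t) (h1 : t ≤ 1)
    (h : (0 ≤ p ∧ 0 ≤ q) ∨ (p ≤ 0 ∧ q ≤ 0)) :
    relu ((1 - t) * p + t * q) = (1 - t) * relu p + t * relu q := by
  have h2 : 0 ≤ 1 - t := by linarith
  unfold relu
  rcases h with ⟨hp, hq⟩ | ⟨hp, hq⟩
  · rw [max_eq_left hp, max_eq_left hq, max_eq_left (by positivity)]
  · rw [max_eq_right hp, max_eq_right hq, max_eq_right (by nlinarith)]; ring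

lemma line_W {n d m : ℕ} {X : Matrix (Fin n) (Fin d) ℝ} {y : Fin n → ℝ} {C : ℝ}
    {W V : Matrix (Fin d) (Fin m) ℝ} {a : Fin m → ℝ}
    (hA : (W, a) ∈ Feas X y C) (hB : (V, a) ∈ Feas X y C)
    (h : ∀ k j, (0 ≤ preA X (fun i => W i j) k ∧ 0 ≤ preA X (fun i => V i j) k) ∨
      (preA X (fun i => W i j) k ≤ 0 ∧ preA X (fun i => V i j) k ≤ 0)) :
    JoinedIn (Feas X y C) (W, a) (V, a) := by
  refine JoinedIn.ofLine
    (f := fun t : ℝ => ((fun i j => (1 - t) * W i j + t * V i j : Matrix (Fin d) (Fin m) ℝ), a))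
    ?_ ?_ ?_ ?_
  · apply Continuous.continuousOn
    refine Continuous.prodMk ?_ continuous_const
    refine continuous_pi fun i => continuous_pi fun j => ?_
    fun_prop
  · simp
  · simp
  · rintro _ ⟨t, ⟨h0, h1⟩, rfl⟩
    refine ⟨fun k => ?_, fun i j => abs_comb_le (hA.2.1 i j) (hB.2.1 i j) h0 h1, hA.2.2⟩
    have e1 := hA.1 k
    have e2 := hB.1 k
    simp only at e1 e2 ⊢
    calc _ = (1 - t) * (∑ j, relu (preA X (fun i => W i j) k) * a j)
          + t * (∑ j, relu (preA X (fun i => V i j) k) * a j) := by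
          simp only [Finset.mul_sum, ← Finset.sum_add_distrib]
          refine Finset.sum_congr rfl fun j _ => ?_
          rw [preA_comb, relu_comb h0 h1 (h k j)]
          ring
      _ = y k := by rw [e1, e2]; ring

lemma sgn_zero_left {p : ℝ} : ((0:ℝ) ≤ 0 ∧ 0 ≤ p) ∨ ((0:ℝ) ≤ 0 ∧ p ≤ 0) := by
  rcases le_total 0 p with h | h
  · exact Or.inl ⟨le_rfl, h⟩
  · exact Or.inr ⟨le_rfl, h⟩

lemma sgn_zero_right {p : ℝ} : (0 ≤ p ∧ (0:ℝ) ≤ 0) ∨ (p ≤ 0 ∧ (0:ℝ) ≤ 0) := by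
  rcases le_total 0 p with h | h
  · exact Or.inl ⟨h, le_rfl⟩
  · exact Or.inr ⟨h, le_rfl⟩

lemma joined_disj {n d m : ℕ} {X : Matrix (Fin n) (Fin d) ℝ} {y : Fin n → ℝ} {C : ℝ}
    {W V : Matrix (Fin d) (Fin m) ℝ} {a b : Fin m → ℝ} (S T : Finset (Fin m))
    (hST : Disjoint S T) (hW : ∀ j ∉ S, ∀ i, W i j = 0) (hV : ∀ j ∉ T, ∀ i, V i j = 0)
    (hA : (W, a) ∈ Feas X y C) (hB : (V, b) ∈ Feas X y C) :
    JoinedIn (Feas X y C) (W, a) (V, b) := by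
  classical
  set c : Fin m → ℝ := fun j => if j ∈ T then b j else a j with hc
  have hcC : ∀ j, |c j| ≤ C := by
    intro j
    simp only [hc]
    split_ifs
    · exact hB.2.2 j
    · exact hA.2.2 j
  have pW : ∀ j ∉ S, ∀ k, preA X (fun i => W i j) k = 0 := by
    intro j hj k
    simp [preA, hW j hj]
  have pV : ∀ j ∉ T, ∀ k, preA X (fun i => V i j) k = 0 := by
    intro j hj k
    simp [preA, hV j hj]
  have h1 : (W, c) ∈ Feas X y C := by
    refine ⟨fun k => ?_, hA.2.1, hcC⟩
    rw [← hA.1 k]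
    refine Finset.sum_congr rfl fun j _ => ?_
    by_cases hj : j ∈ T
    · have := pW j (fun h => Finset.disjoint_left.mp hST h hj) k
      simp [this, relu_zero']
    · simp [hc, hj]
  have h2 : (V, c) ∈ Feas X y C := by
    refine ⟨fun k => ?_, hB.2.1, hcC⟩
    rw [← hB.1 k]
    refine Finset.sum_congr rfl fun j _ => ?_
    by_cases hj : j ∈ T
    · simp [hc, hj]
    · simp [pV j hj k, relu_zero']
  refine (line_alpha hA h1).trans ((line_W h1 h2 ?_).trans (line_alpha h2 hB))
  intro k j
  by_cases hj : j ∈ T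
  · rw [pW j (fun h => Finset.disjoint_left.mp hST h hj) k]
    exact sgn_zero_left
  · rw [pV j hj k]
    exact sgn_zero_right

noncomputable def sg (b : Bool) : ℝ := if b then 1 else -1

lemma sg_cases (b : Bool) : sg b = 1 ∨ sg b = -1 := by cases b <;> simp [sg]

lemma sg_abs (b : Bool) : |sg b| = 1 := by cases b <;> simp [sg]

lemma sg_decide (x : ℝ) : 0 ≤ sg (decide (0 ≤ x)) * x := by
  by_cases h : 0 ≤ x
  · simp [sg, h]
  · simp [sg, h]; linarith

lemma step0 {n d m : ℕ} {X : Matrix (Fin n) (Fin d) ℝ} {y : Fin n → ℝ} {C : ℝ} (hC : 0 < C)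
    {W : Matrix (Fin d) (Fin m) ℝ} {a : Fin m → ℝ} (hA : (W, a) ∈ Feas X y C) :
    ∃ (V : Matrix (Fin d) (Fin m) ℝ) (s : Fin m → Bool),
      (V, fun j => C * sg (s j)) ∈ Feas X y C ∧
      JoinedIn (Feas X y C) (W, a) (V, fun j => C * sg (s j)) := by
  classical
  set U : Matrix (Fin d) (Fin m) ℝ := fun i j => if a j = 0 then 0 else W i j with hU
  set s : Fin m → Bool := fun j => decide (0 ≤ a j) with hs
  have hU1 : (U, a) ∈ Feas X y C := by
    refine ⟨fun k => ?_, fun i j => ?_, hA.2.2⟩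
    · rw [← hA.1 k]
      refine Finset.sum_congr rfl fun j _ => ?_
      by_cases hj : a j = 0
      · simp [hj]
      · simp [hU, hj]
    · simp only [hU]
      split_ifs
      · simpa using hC.le
      · exact hA.2.1 i j
  have hj1 : JoinedIn (Feas X y C) (W, a) (U, a) := by
    refine line_W hA hU1 fun k j => ?_
    by_cases hj : a j = 0
    · simp only [hU, hj, if_true, preA_zero]
      exact sgn_zero_right
    · simp only [hU, hj, if_false]
      rcases le_total 0 (preA X (fun i => W i j) k) with h | h <;> simp [h]
  set g : ℝ → Fin m → ℝ := fun t j => (1 - t) * |a j| + t * C with hg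
  have hsa : ∀ j, sg (s j) * |a j| = a j := by
    intro j
    by_cases h : 0 ≤ a j
    · simp [hs, sg, h, abs_of_nonneg h]
    · simp [hs, sg, h, abs_of_neg (not_le.mp h)]
  have hgpos : ∀ j, a j ≠ 0 → ∀ t, 0 ≤ t → t ≤ 1 → 0 < g t j := by
    intro j hj t h0 h1
    have := abs_pos.mpr hj
    have := hA.2.2 j
    simp only at this
    simp only [hg]
    nlinarith
  have hge : ∀ j, ∀ t, 0 ≤ t → t ≤ 1 → |a j| ≤ g t j := by
    intro j t h0 h1
    have := hA.2.2 j
    simp only at this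
    simp only [hg]
    nlinarith
  set f : ℝ → Matrix (Fin d) (Fin m) ℝ × (Fin m → ℝ) := fun t =>
    ((fun i j => (|a j| / g t j) * U i j : Matrix (Fin d) (Fin m) ℝ), fun j => g t j * sg (s j))
    with hf
  have hfF : ∀ t ∈ Set.Icc (0:ℝ) 1, f t ∈ Feas X y C := by
    rintro t ⟨h0, h1⟩
    refine ⟨fun k => ?_, fun i j => ?_, fun j => ?_⟩
    · rw [← hU1.1 k]
      refine Finset.sum_congr rfl fun j _ => ?_
      simp only [hf]
      have hnn : 0 ≤ |a j| / g t j := div_nonneg (abs_nonneg _) ((abs_nonneg _).trans (hge j t h0 h1))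
      rw [preA_smul, relu_smul hnn]
      by_cases hj : a j = 0
      · simp [hj]
      · have := (hgpos j hj t h0 h1).ne'
        conv_rhs => rw [← hsa j]
        field_simp
    · simp only [hf]
      rw [abs_mul]
      have hnn : 0 ≤ |a j| / g t j := div_nonneg (abs_nonneg _) ((abs_nonneg _).trans (hge j t h0 h1))
      have hle : |a j| / g t j ≤ 1 := div_le_one_of_le₀ (hge j t h0 h1)
        ((abs_nonneg _).trans (hge j t h0 h1))
      rw [abs_of_nonneg hnn]
      have := hU1.2.1 i j
      simp only at this
      nlinarith [abs_nonneg (U i j)]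
    · simp only [hf]
      rw [abs_mul, sg_abs, mul_one, abs_of_nonneg ((abs_nonneg _).trans (hge j t h0 h1))]
      have := hA.2.2 j
      simp only at this
      simp only [hg]
      nlinarith
  have hf0 : f 0 = (U, a) := by
    simp only [hf, hg]
    refine Prod.ext ?_ ?_
    · funext i j
      by_cases hj : a j = 0
      · simp [hU, hj]
      · simp [hj]
    · funext j
      simp only [sub_zero, one_mul, zero_mul, add_zero]
      rw [mul_comm, hsa]
  refine ⟨fun i j => (|a j| / C) * U i j, s, ?_, ?_⟩
  · have := hfF 1 ⟨zero_le_one, le_rfl⟩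
    simpa [hf, hg] using this
  · refine hj1.trans (JoinedIn.ofLine (f := f) ?_ hf0 ?_ ?_)
    · simp only [hf]
      refine ContinuousOn.prodMk ?_ ?_
      · refine continuousOn_pi.mpr fun i => continuousOn_pi.mpr fun j => ?_
        by_cases hj : a j = 0
        · simp only [hj, abs_zero, zero_div, zero_mul]
          exact continuousOn_const
        · refine ContinuousOn.mul (ContinuousOn.div continuousOn_const ?_ ?_) continuousOn_const
          · simp only [hg]; fun_prop
          · rintro t ⟨h0, h1⟩
            exact (hgpos j hj t h0 h1).ne'
      · simp only [hg]; fun_prop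
    · simp [hf, hg]
    · rintro _ ⟨t, ht, rfl⟩
      exact hfF t ht

/-- Solutions of a linear system over a polyhedral cone dominate bounded solutions. -/
lemma exists_bounded_dominated {E κ G : Type*} [NormedAddCommGroup E] [NormedSpace ℝ E]
    [FiniteDimensional ℝ E] [Fintype κ] [NormedAddCommGroup G] [NormedSpace ℝ G]
    (s : E →ₗ[ℝ] (κ → ℝ)) (hs : Function.Injective s) (T : E →ₗ[ℝ] G) (y : G) :
    ∃ L : ℝ, ∀ z, 0 ≤ s z → T z = y → ∃ z', 0 ≤ s z' ∧ s z' ≤ s z ∧ T z' = y ∧ ‖z'‖ ≤ L := by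
  have cs : Continuous s := s.continuous_of_finiteDimensional
  have cT : Continuous T := T.continuous_of_finiteDimensional
  have key : ∃ L : ℝ, ∀ z, 0 ≤ s z → T z = y → L < ‖z‖ →
      ∃ z0, z0 ≠ 0 ∧ 0 ≤ s z0 ∧ T z0 = 0 ∧ s z0 ≤ s z := by
    by_contra hcon
    push Not at hcon
    choose z hz0 hzT hzn hz using fun k : ℕ => hcon (k : ℝ)
    have hpos : ∀ k, 0 < ‖z k‖ := fun k => lt_of_le_of_lt (Nat.cast_nonneg k) (hzn k)
    set u : ℕ → E := fun k => ‖z k‖⁻¹ • z k with hu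
    have hus : ∀ k, u k ∈ Metric.sphere (0 : E) 1 := by
      intro k
      simp [hu, norm_smul, (hpos k).ne']
    obtain ⟨v, hv, φ, hφ, hlim⟩ := (isCompact_sphere (0 : E) 1).tendsto_subseq hus
    have hv1 : ‖v‖ = 1 := by simpa using hv
    have hnorm : Filter.Tendsto (fun k => ‖z (φ k)‖) Filter.atTop Filter.atTop := by
      refine Filter.tendsto_atTop_mono (fun k => ?_) tendsto_natCast_atTop_atTop
      exact le_trans (Nat.cast_le.mpr (hφ.id_le k)) (hzn (φ k)).le
    have hsl : Filter.Tendsto (fun k => s (u (φ k))) Filter.atTop (nhds (s v)) :=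
      (cs.tendsto v).comp hlim
    have hsu : ∀ k, 0 ≤ s (u k) := by
      intro k
      simp only [hu, map_smul]
      exact smul_nonneg (inv_nonneg.mpr (hpos k).le) (hz0 k)
    have hsv : 0 ≤ s v := ge_of_tendsto' hsl fun k => hsu _
    have hTv : T v = 0 := by
      have h1 : Filter.Tendsto (fun k => T (u (φ k))) Filter.atTop (nhds (T v)) :=
        (cT.tendsto v).comp hlim
      have h2 : Filter.Tendsto (fun k => T (u (φ k))) Filter.atTop (nhds 0) := by
        have : (fun k => T (u (φ k))) = fun k => ‖z (φ k)‖⁻¹ • y := by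
          funext k
          simp [hu, hzT]
        rw [this]
        simpa using (hnorm.inv_tendsto_atTop).smul_const y
      exact tendsto_nhds_unique h1 h2
    have hev : ∀ c, ∀ᶠ k in Filter.atTop, s v c ≤ s (z (φ k)) c := by
      intro c
      rcases (hsv c).eq_or_lt with h | h
      · refine Filter.Eventually.of_forall fun k => ?_
        rw [← h]
        exact hz0 _ c
      · have hc : Filter.Tendsto (fun k => s (u (φ k)) c) Filter.atTop (nhds (s v c)) :=
          (tendsto_pi_nhds.mp hsl) c
        have h' : s v c / 2 < s v c := by
          have : (0:ℝ) < s v c := h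
          linarith
        filter_upwards [hc.eventually (lt_mem_nhds h'), hnorm.eventually_ge_atTop 2] with k hk1 hk2
        have : s (z (φ k)) c = ‖z (φ k)‖ * s (u (φ k)) c := by
          simp [hu, (hpos (φ k)).ne']
        rw [this]
        have h'' : (0:ℝ) < s v c := h
        nlinarith
    obtain ⟨k, hk⟩ := (Filter.eventually_all.mpr hev).exists
    refine hz (φ k) v ?_ hsv hTv hk
    intro h
    simp [h] at hv1
  obtain ⟨L, hL⟩ := key
  refine ⟨L, fun z hz hzT => ?_⟩
  have hce := LinearMap.isClosedEmbedding_of_injective (f := s) (LinearMap.ker_eq_bot.mpr hs)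
  have hK : IsCompact (s ⁻¹' (Set.Icc 0 (s z)) ∩ T ⁻¹' {y}) :=
    (hce.isCompact_preimage isCompact_Icc).inter_right (isClosed_singleton.preimage cT)
  obtain ⟨w, ⟨⟨hw0, hw1⟩, hwT⟩, hmin⟩ := hK.exists_isMinOn ⟨z, ⟨⟨hz, le_rfl⟩, hzT⟩⟩
    (f := fun w => ∑ c, s w c) (Continuous.continuousOn (by fun_prop))
  refine ⟨w, hw0, hw1, hwT, ?_⟩
  by_contra hlt
  obtain ⟨v, hv, hv0, hvT, hvw⟩ := hL w hw0 hwT (not_le.mp hlt)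
  have hm := hmin (show w - v ∈ s ⁻¹' (Set.Icc 0 (s z)) ∩ T ⁻¹' {y} from by
    refine ⟨⟨?_, ?_⟩, ?_⟩
    · rw [map_sub]; exact sub_nonneg.mpr hvw
    · rw [map_sub]; exact (sub_le_self _ hv0).trans hw1
    · simp only [Set.mem_preimage, map_sub, hvT, sub_zero]; exact hwT)
  simp only [Set.mem_ofPred_eq, map_sub, Pi.sub_apply, Finset.sum_sub_distrib] at hm
  have hz : ∑ c, s v c = 0 := le_antisymm (by linarith) (Finset.sum_nonneg fun c _ => hv0 c)
  rw [Finset.sum_eq_zero_iff_of_nonneg (fun c _ => hv0 c)] at hz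
  apply hv
  apply hs
  rw [map_zero]
  funext c
  exact hz c (Finset.mem_univ c)

abbrev Blk (n d : ℕ) := Bool × (Fin n ⊕ Fin d → Bool)

noncomputable def extv {n d : ℕ} (X : Matrix (Fin n) (Fin d) ℝ) (w : Fin d → ℝ) :
    Fin n ⊕ Fin d → ℝ := Sum.elim (preA X w) w

lemma preA_add {n d : ℕ} (X : Matrix (Fin n) (Fin d) ℝ) (w v : Fin d → ℝ) (k : Fin n) :
    preA X (w + v) k = preA X w k + preA X v k := by
  have := preA_comb X 1 1 w v k
  simpa [Pi.add_def] using this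

lemma preA_smul' {n d : ℕ} (X : Matrix (Fin n) (Fin d) ℝ) (c : ℝ) (w : Fin d → ℝ) (k : Fin n) :
    preA X (c • w) k = c * preA X w k := preA_smul X c w k

noncomputable def extL {n d : ℕ} (X : Matrix (Fin n) (Fin d) ℝ) :
    (Fin d → ℝ) →ₗ[ℝ] (Fin n ⊕ Fin d → ℝ) where
  toFun := extv X
  map_add' w v := by
    funext c
    cases c <;> simp [extv, preA_add]
  map_smul' a w := by
    funext c
    cases c <;> simp [extv, preA_smul']

noncomputable def sMap {n d : ℕ} (X : Matrix (Fin n) (Fin d) ℝ) :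
    (Blk n d → Fin d → ℝ) →ₗ[ℝ] (Blk n d × (Fin n ⊕ Fin d) → ℝ) where
  toFun z p := sg (p.1.2 p.2) * extL X (z p.1) p.2
  map_add' z w := by
    funext p
    simp [mul_add]
  map_smul' a w := by
    funext p
    simp
    ring

noncomputable def TMap {n d : ℕ} (X : Matrix (Fin n) (Fin d) ℝ) (C : ℝ) :
    (Blk n d → Fin d → ℝ) →ₗ[ℝ] (Fin n → ℝ) where
  toFun z k := ∑ b, C * sg b.1 * (if b.2 (Sum.inl k) then extL X (z b) (Sum.inl k) else 0)
  map_add' z w := by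
    funext k
    simp only [Pi.add_apply, map_add, ← Finset.sum_add_distrib]
    refine Finset.sum_congr rfl fun b _ => ?_
    split_ifs <;> ring
  map_smul' a w := by
    funext k
    simp only [Pi.smul_apply, map_smul, smul_eq_mul, Finset.mul_sum, RingHom.id_apply]
    refine Finset.sum_congr rfl fun b _ => ?_
    split_ifs <;> ring

lemma sMap_inj {n d : ℕ} (X : Matrix (Fin n) (Fin d) ℝ) : Function.Injective (sMap X) := by
  rw [← LinearMap.ker_eq_bot, LinearMap.ker_eq_bot']
  intro z hz
  funext b i
  have := congrFun hz (b, Sum.inr i)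
  simp only [sMap, extL, extv, LinearMap.coe_mk, AddHom.coe_mk, Sum.elim_inr, Pi.zero_apply,
    mul_eq_zero] at this
  rcases this with h | h
  · rcases sg_cases (b.2 (Sum.inr i)) with h' | h' <;> rw [h'] at h <;> norm_num at h
  · exact h

lemma relu_sg {b : Bool} {x : ℝ} (h : 0 ≤ sg b * x) : relu x = if b then x else 0 := by
  cases b
  · have : x ≤ 0 := by simp [sg] at h; linarith
    simp [relu, this]
  · have : 0 ≤ x := by simpa [sg] using h
    simp [relu, this]

/-- Output of a network all of whose neurons lie in prescribed blocks. -/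
lemma out_eq_TMap {n d m : ℕ} (X : Matrix (Fin n) (Fin d) ℝ) (C : ℝ)
    (W : Matrix (Fin d) (Fin m) ℝ) (b : Fin m → Blk n d)
    (hb : ∀ j c, 0 ≤ sg ((b j).2 c) * extL X (fun i => W i j) c)
    (z : Blk n d → Fin d → ℝ)
    (hz : ∀ β, ∑ j with b j = β, (fun i => W i j) = z β) (k : Fin n) :
    ∑ j, relu (preA X (fun i => W i j) k) * (C * sg (b j).1) = TMap X C z k := by
  classical
  have h1 : ∀ j, relu (preA X (fun i => W i j) k) * (C * sg (b j).1) =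
      C * sg (b j).1 * (if (b j).2 (Sum.inl k) then extL X (fun i => W i j) (Sum.inl k) else 0) := by
    intro j
    rw [mul_comm]
    congr 1
    exact relu_sg (hb j (Sum.inl k))
  simp only [h1, TMap, LinearMap.coe_mk, AddHom.coe_mk]
  rw [← Finset.sum_fiberwise (s := Finset.univ) (g := b)]
  refine Finset.sum_congr rfl fun β _ => ?_
  rw [← hz β, map_sum]
  rw [Finset.sum_congr rfl (g := fun j => C * sg β.1 *
    (if β.2 (Sum.inl k) then extL X (fun i => W i j) (Sum.inl k) else 0))
    (fun j hj => by rw [(Finset.mem_filter.mp hj).2])]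
  rw [← Finset.mul_sum]
  split_ifs
  · rw [Finset.sum_apply]
  · simp

lemma reduce {n d : ℕ} (X : Matrix (Fin n) (Fin d) ℝ) (y : Fin n → ℝ) {C : ℝ} (hC : 0 < C) :
    ∃ K : ℕ, ∀ (m : ℕ) (A : Matrix (Fin d) (Fin m) ℝ × (Fin m → ℝ)), A ∈ Feas X y C →
      ∃ B ∈ Feas X y C, JoinedIn (Feas X y C) A B ∧
        ∃ S : Finset (Fin m), S.card ≤ K ∧ ∀ j ∉ S, ∀ i, B.1 i j = 0 := by
  classical
  obtain ⟨L, hL⟩ := exists_bounded_dominated (sMap X) (sMap_inj X) (TMap X C) y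
  obtain ⟨r, hr⟩ := exists_nat_ge (L / C)
  rw [div_le_iff₀ hC] at hr
  refine ⟨Fintype.card (Blk n d) * (r + 1), ?_⟩
  rintro m ⟨W0, a0⟩ hA0
  obtain ⟨W, s, hA, hJ⟩ := step0 hC hA0
  set b : Fin m → Blk n d := fun j => (s j, fun c => decide (0 ≤ extL X (fun i => W i j) c)) with hbdef
  have hb : ∀ j c, 0 ≤ sg ((b j).2 c) * extL X (fun i => W i j) c := fun j c => sg_decide _
  set Z : Blk n d → Fin d → ℝ := fun β => ∑ j with b j = β, (fun i => W i j) with hZ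
  have hsZ : ∀ β c, sMap X Z (β, c) = ∑ j with b j = β, sg (β.2 c) * extL X (fun i => W i j) c := by
    intro β c
    simp only [sMap, LinearMap.coe_mk, AddHom.coe_mk, hZ, map_sum, Finset.sum_apply, Finset.mul_sum]
  have hZ0 : 0 ≤ sMap X Z := by
    rintro ⟨β, c⟩
    rw [hsZ]
    refine Finset.sum_nonneg fun j hj => ?_
    rw [← (Finset.mem_filter.mp hj).2]
    exact hb j c
  have hZT : TMap X C Z = y := by
    funext k
    rw [← out_eq_TMap X C W b hb Z (fun β => rfl) k]
    exact hA.1 k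
  obtain ⟨z, hz0, hz1, hzT, hzn⟩ := hL Z hZ0 hZT
  -- the fibres and chosen subsets
  set F : Blk n d → Finset (Fin m) := fun β => Finset.univ.filter fun j => b j = β with hF
  have hsub : ∀ β, ∃ t ⊆ F β, t.card = min (F β).card (r + 1) := fun β =>
    Finset.exists_subset_card_eq (min_le_left _ _)
  choose t htF htc using hsub
  have hzle : ∀ β i, |z β i| ≤ (F β).card * C := by
    intro β i
    have h0 : 0 ≤ sg (β.2 (Sum.inr i)) * z β i := hz0 (β, Sum.inr i)
    have h1 : sg (β.2 (Sum.inr i)) * z β i ≤ sg (β.2 (Sum.inr i)) * Z β i := hz1 (β, Sum.inr i)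
    have h2 : |z β i| = sg (β.2 (Sum.inr i)) * z β i := by
      rw [← abs_of_nonneg h0, abs_mul, sg_abs, one_mul]
    have h3 : sg (β.2 (Sum.inr i)) * Z β i ≤ |Z β i| := by
      calc _ ≤ |sg (β.2 (Sum.inr i)) * Z β i| := le_abs_self _
        _ = _ := by rw [abs_mul, sg_abs, one_mul]
    have h4 : |Z β i| ≤ (F β).card * C := by
      simp only [hZ, Finset.sum_apply]
      refine (Finset.abs_sum_le_sum_abs _ _).trans ?_
      refine (Finset.sum_le_card_nsmul _ _ C (fun j _ => hA.2.1 i j)).trans ?_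
      simp [hF]
    linarith
  have hzL : ∀ β i, |z β i| ≤ ((r + 1 : ℕ) : ℝ) * C := by
    intro β i
    have h1 : ‖z β i‖ ≤ ‖z‖ := (norm_le_pi_norm (z β) i).trans (norm_le_pi_norm z β)
    rw [Real.norm_eq_abs] at h1
    push_cast
    nlinarith
  have hzt : ∀ β i, |z β i| ≤ (t β).card * C := by
    intro β i
    rw [htc]
    rcases min_choice (F β).card (r + 1) with h | h <;> rw [h]
    · exact hzle β i
    · exact hzL β i
  set V : Matrix (Fin d) (Fin m) ℝ :=
    fun i j => (if j ∈ t (b j) then ((t (b j)).card : ℝ)⁻¹ else 0) * z (b j) i with hV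
  have hcoef : ∀ j, 0 ≤ (if j ∈ t (b j) then ((t (b j)).card : ℝ)⁻¹ else 0) := by
    intro j
    split_ifs
    · positivity
    · exact le_rfl
  have hbV : ∀ j c, 0 ≤ sg ((b j).2 c) * extL X (fun i => V i j) c := by
    intro j c
    have : (fun i => V i j) = (if j ∈ t (b j) then ((t (b j)).card : ℝ)⁻¹ else 0) • z (b j) := by
      funext i
      simp only [hV, Pi.smul_apply, smul_eq_mul]
    rw [this, map_smul, Pi.smul_apply, smul_eq_mul, mul_left_comm]
    exact mul_nonneg (hcoef j) (hz0 (b j, c))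
  have hVz : ∀ β, ∑ j with b j = β, (fun i => V i j) = z β := by
    intro β
    funext i
    rw [Finset.sum_apply]
    have h1 : ∑ j with b j = β, V i j =
        ∑ j ∈ F β, if j ∈ t β then ((t β).card : ℝ)⁻¹ * z β i else 0 := by
      refine Finset.sum_congr rfl fun j hj => ?_
      simp only [hV, (Finset.mem_filter.mp hj).2, ite_mul, zero_mul]
    rw [h1, Finset.sum_ite_mem, Finset.inter_eq_right.mpr (htF β), Finset.sum_const, nsmul_eq_mul]
    by_cases h : (t β).card = 0
    · have := hzt β i
      rw [h] at this
      simp at this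
      simp [this]
    · have : ((t β).card : ℝ) ≠ 0 := by exact_mod_cast h
      field_simp
  have hVF : (V, fun j => C * sg (s j)) ∈ Feas X y C := by
    refine ⟨fun k => ?_, fun i j => ?_, hA.2.2⟩
    · rw [← hzT]
      exact out_eq_TMap X C V b hbV z hVz k
    · simp only [hV]
      split_ifs with h
      · have hp : (0:ℝ) < (t (b j)).card := by
          exact_mod_cast Finset.card_pos.mpr ⟨j, h⟩
        rw [abs_mul, abs_of_pos (inv_pos.mpr hp), inv_mul_le_iff₀ hp]
        exact hzt (b j) i
      · simpa using hC.le
  refine ⟨_, hVF, hJ.trans (line_W hA hVF fun k j => ?_), Finset.univ.biUnion t, ?_, ?_⟩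
  · have h1 := hb j (Sum.inl k)
    have h2 := hbV j (Sum.inl k)
    change 0 ≤ _ * preA X (fun i => W i j) k at h1
    change 0 ≤ _ * preA X (fun i => V i j) k at h2
    rcases sg_cases ((b j).2 (Sum.inl k)) with h | h <;> rw [h] at h1 h2
    · exact Or.inl ⟨by linarith, by linarith⟩
    · exact Or.inr ⟨by linarith, by linarith⟩
  · refine Finset.card_biUnion_le_card_mul _ _ _ fun β _ => ?_
    rw [htc]
    exact min_le_right _ _
  · intro j hj i
    have : j ∉ t (b j) := fun h => hj (Finset.mem_biUnion.mpr ⟨_, Finset.mem_univ _, h⟩)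
    simp [hV, this]

lemma feas_perm {n d m : ℕ} {X : Matrix (Fin n) (Fin d) ℝ} {y : Fin n → ℝ} {C : ℝ}
    {W : Matrix (Fin d) (Fin m) ℝ} {a : Fin m → ℝ} (hA : (W, a) ∈ Feas X y C)
    (σ : Equiv.Perm (Fin m)) :
    ((fun i j => W i (σ j) : Matrix (Fin d) (Fin m) ℝ), fun j => a (σ j)) ∈ Feas X y C := by
  refine ⟨fun k => ?_, fun i j => hA.2.1 i (σ j), fun j => hA.2.2 (σ j)⟩
  rw [← hA.1 k]
  exact Equiv.sum_comp σ (fun j => relu (preA X (fun i => W i j) k) * a j)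

/-- there is a critical width `m*`, depending only on `(X, y, λ)`, such that
for every width `m ≥ m*` the set `O_{‖·‖_max}(λ)` is path-connected. -/
theorem intra_connectivity_maxNorm {n d : ℕ}
    (X : Matrix (Fin n) (Fin d) ℝ) (y : Fin n → ℝ)
    (lam : ℝ) (hlam : 0 < lam) :
    ∃ mstar : ℕ, 0 < mstar ∧ ∀ m : ℕ, mstar ≤ m →
      ∀ A ∈ solSet (M := Fin m) X y maxNorm linfNorm lam,
        ∀ B ∈ solSet (M := Fin m) X y maxNorm linfNorm lam,
          JoinedIn (solSet (M := Fin m) X y maxNorm linfNorm lam) A B := by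
  classical
  have hC : 0 < 1 / lam := by positivity
  obtain ⟨K, hK⟩ := reduce X y hC
  refine ⟨3 * K + 1, by omega, fun m hm => ?_⟩
  rw [solSet_eq X y lam hlam]
  intro A hA B hB
  obtain ⟨⟨W, a⟩, hA', hAA, S, hS, hSW⟩ := hK m A hA
  obtain ⟨⟨V, b⟩, hB', hBB, T, hT, hTV⟩ := hK m B hB
  refine hAA.trans (JoinedIn.trans ?_ hBB.symm)
  have hcard : S.card ≤ ((S ∪ T)ᶜ).card := by
    rw [Finset.card_compl, Fintype.card_fin]
    have := Finset.card_union_le S T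
    omega
  obtain ⟨R, hR, hRc⟩ := Finset.exists_subset_card_eq hcard
  have e : {x // x ∈ R} ≃ {x // x ∈ S} := Finset.equivOfCardEq hRc
  have hP := feas_perm hA' e.extendSubtype
  have hRW : ∀ j ∉ R, ∀ i, W i (e.extendSubtype j) = 0 := fun j hj i =>
    hSW _ (e.extendSubtype_not_mem j hj) i
  have hSR : Disjoint S R := by
    rw [Finset.disjoint_left]
    intro x hx hxR
    have := hR hxR
    simp [hx] at this
  have hRT : Disjoint R T := by
    rw [Finset.disjoint_left]
    intro x hxR hx
    have := hR hxR
    simp [hx] at this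
  exact (joined_disj S R hSR hSW hRW hA' hP).trans (joined_disj R T hRT hRW hTV hP hB')
end
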